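/- arXiv:1709.02071 — 6 statements merged into one kernel-verified Lean document; each statement's English description precedes it below -/
import Mathlib

section
/- For all integers x ≥ 1 and a ≥ 0, the quantity P_{x,x,a} given by Proctor's product formula satisfies P_{x,x,a} / P_{x-1,x-1,a} = ((a+x)/x) · ((2a+2x-1)!/(2a+x)!) · (x!/(2x-1)!). -/
open Finset Nat

/-- Pochhammer symbol `(q)_n` for real `q` and integer `n`. -/
noncomputable def poch (q : ℝ) (n : ℤ) : ℝ :=
  if 0 ≤ n then ∏ i ∈ Finset.range n.toNat, (q + i)
  else 1 / ∏ i ∈ Finset.range (-n).toNat, (q - (i + 1))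

/-- Skipping Pochhammer symbol `[q]_n`. -/
noncomputable def spoch (q : ℝ) (n : ℤ) : ℝ :=
  if 0 ≤ n then ∏ i ∈ Finset.range n.toNat, (q + 2 * i)
  else 1 / ∏ i ∈ Finset.range (-n).toNat, (q - 2 * (i + 1))

/-- Trapezoidal product `T(q,n,m) = ∏_{i=0}^{m-1} (q+i)_{n-2i}`. -/
noncomputable def trapT (q : ℝ) (n m : ℤ) : ℝ :=
  ∏ i ∈ Finset.range m.toNat, poch (q + i) (n - 2 * i)

/-- Skipping trapezoidal product `V(q,n,m) = ∏_{i=0}^{m-1} [q+2i]_{n-2i}`. -/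
noncomputable def trapV (q : ℝ) (n m : ℤ) : ℝ :=
  ∏ i ∈ Finset.range m.toNat, spoch (q + 2 * i) (n - 2 * i)

/-- Hyperfactorial `H(n) = 0!·1!·2!⋯(n-1)!`. -/
def hyperfac (n : ℕ) : ℕ := ∏ i ∈ Finset.range n, i !

/-- Skipping hyperfactorial `H₂(n)`:
`0!·2!·4!⋯(n-2)!` if `n` is even, `1!·3!·5!⋯(n-2)!` if `n` is odd. -/
def hyperfac2 (n : ℕ) : ℕ :=
  ∏ i ∈ Finset.range (n / 2), (if n % 2 = 0 then (2 * i)! else (2 * i + 1)!)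

/-- Partial sum `s_k(t) = t 1 + ⋯ + t k` (sequences are indexed from 1). -/
def pSum (t : ℕ → ℕ) (k : ℕ) : ℕ := ∑ i ∈ Finset.Icc 1 k, t i

/-- `E(t) = t 2 + t 4 + ⋯ + t (2l)` for a sequence of length `2l`. -/
def evenSum (l : ℕ) (t : ℕ → ℕ) : ℕ := ∑ i ∈ Finset.Icc 1 l, t (2 * i)

/-- `Q(t₁,…,t_{2l})`. -/
noncomputable def Qfun (l : ℕ) (t : ℕ → ℕ) : ℝ :=
  ((∏ i ∈ Finset.Icc 1 l, ((pSum t (2 * i))! : ℝ) / ((pSum t (2 * i - 1))! : ℝ)) /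
      (hyperfac2 (2 * evenSum l t + 1) : ℝ)) *
    (∏ i ∈ Finset.Icc 1 l,
      ((hyperfac2 (2 * pSum t (2 * i) + 1) : ℝ) * (hyperfac (2 * pSum t (2 * i - 1) + 2) : ℝ)) /
        (hyperfac2 (2 * pSum t (2 * i - 1) + 3) : ℝ)) *
    (∏ p ∈ (Finset.Icc 1 (2 * l) ×ˢ Finset.Icc 1 (2 * l)).filter
        (fun p => p.1 < p.2 ∧ (p.2 - p.1) % 2 = 1),
      (hyperfac (pSum t p.2 - pSum t p.1) : ℝ) / (hyperfac (pSum t p.2 + pSum t p.1 + 1) : ℝ)) *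
    (∏ p ∈ (Finset.Icc 1 (2 * l) ×ˢ Finset.Icc 1 (2 * l)).filter
        (fun p => p.1 < p.2 ∧ (p.2 - p.1) % 2 = 0),
      (hyperfac (pSum t p.2 + pSum t p.1 + 1) : ℝ) / (hyperfac (pSum t p.2 - pSum t p.1) : ℝ))

/-- Build an indexed-from-1 sequence from a list. -/
def seqOf (L : List ℕ) : ℕ → ℕ := fun i => L.getD (i - 1) 0

/-- `Q` on four entries. -/
noncomputable def Q4 (t1 t2 t3 t4 : ℕ) : ℝ := Qfun 2 (seqOf [t1, t2, t3, t4])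

/-- Proctor's product formula `P_{a,b,c}`. -/
noncomputable def Pf (a b c : ℕ) : ℝ :=
  ∏ i ∈ Finset.Icc 1 a,
    ((∏ j ∈ Finset.Icc 1 (b - a + 1), ((c + i + j - 1 : ℕ) : ℝ) / ((i + j - 1 : ℕ) : ℝ)) *
      ∏ j ∈ Finset.Icc (b - a + 2) (b - a + i),
        ((2 * c + i + j - 1 : ℕ) : ℝ) / ((i + j - 1 : ℕ) : ℝ))

/-- Ciucu's product formula `P′_{a,b,c}`. -/
noncomputable def Pf' (a b c : ℕ) : ℝ :=
  (2 : ℝ) ^ (-(a : ℤ)) *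
    (∏ i ∈ Finset.Icc 1 a, ((2 * c + (b - a) + i : ℕ) : ℝ) / ((c + (b - a) + i : ℕ) : ℝ)) *
    Pf a b c

/-- `φ_{x,y,z}(a,b)`. -/
noncomputable def phi (x y z a b : ℕ) : ℝ :=
  (Pf y (y + 2 * a) b * Pf (z + b) (z + b) a * Q4 a b x (y + z) /
      Pf (y + z + b) (y + z + b) a) *
    (trapT ((x : ℝ) + b + 1) ((y : ℤ) + a - 1) a *
      trapT ((x : ℝ) + z + a + b + 2) ((y : ℤ) + a - 1) a *
      trapT (2 * (a : ℝ) + b + 2) ((y : ℤ) + b - 1) b *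
      trapT ((z : ℝ) + 1) ((y : ℤ) + b - 1) b) /
    (trapT ((b : ℝ) + 1) ((y : ℤ) + a - 1) a *
      trapT ((z : ℝ) + a + b + 2) ((y : ℤ) + a - 1) a *
      trapT ((x : ℝ) + 2 * a + b + 2) ((y : ℤ) + b - 1) b *
      trapT ((x : ℝ) + z + 1) ((y : ℤ) + b - 1) b)

/-- `ψ_{x,y,z}(a,b)`. -/
noncomputable def psi (x y z a b : ℕ) : ℝ :=
  (Pf' y (y + 2 * a + 1) b * Pf (z + b) (z + b) a * Q4 a b x (y + z) /
      Pf (y + z + b) (y + z + b) a) *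
    (trapV (2 * (a : ℝ) + 2 * b + 3) ((y : ℤ) + z - 1) y /
      trapV (2 * (x : ℝ) + 2 * a + 2 * b + 3) ((y : ℤ) + z - 1) y) *
    (trapT ((x : ℝ) + b + 1) ((y : ℤ) + z + 2 * a) y *
      trapT (2 * (a : ℝ) + b + 2) ((y : ℤ) + b - 1) b *
      trapT ((z : ℝ) + 1) ((y : ℤ) + b - 1) b) /
    (trapT ((b : ℝ) + 1) ((y : ℤ) + z + 2 * a) y *
      trapT ((x : ℝ) + 2 * a + b + 2) ((y : ℤ) + b - 1) b *
      trapT ((x : ℝ) + z + 1) ((y : ℤ) + b - 1) b)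

theorem aux_prod (N M k : ℕ) :
    ∏ j ∈ Finset.Icc 2 (k + 1), ((N + j - 1 : ℕ) : ℝ) / ((M + j - 1 : ℕ) : ℝ) =
      (((N + k)! : ℝ) / (N ! : ℝ)) * ((M ! : ℝ) / ((M + k)! : ℝ)) := by
  induction k with
  | zero =>
    have h1 : (N ! : ℝ) ≠ 0 := by positivity
    have h2 : (M ! : ℝ) ≠ 0 := by positivity
    simp [h1, h2]
  | succ k ih =>
    rw [Finset.prod_Icc_succ_top (by omega), ih]
    have e1 : N + (k + 1 + 1) - 1 = N + k + 1 := by omega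
    have e2 : M + (k + 1 + 1) - 1 = M + k + 1 := by omega
    rw [e1, e2, ← add_assoc N k 1, ← add_assoc M k 1, Nat.factorial_succ (N + k),
      Nat.factorial_succ (M + k), Nat.cast_mul, Nat.cast_mul]
    have h1 : (N ! : ℝ) ≠ 0 := by positivity
    have h2 : ((M + k)! : ℝ) ≠ 0 := by positivity
    have h3 : ((M + k + 1 : ℕ) : ℝ) ≠ 0 := by positivity
    field_simp

theorem aux_pos (n a : ℕ) : Pf n n a ≠ 0 := by
  unfold Pf
  refine Finset.prod_ne_zero_iff.mpr fun i hi => mul_ne_zero ?_ ?_ <;>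
  · refine Finset.prod_ne_zero_iff.mpr fun j hj => ?_
    rw [Finset.mem_Icc] at hi hj
    refine div_ne_zero ?_ ?_ <;> · rw [Nat.cast_ne_zero]; omega

/-- ratio of consecutive Proctor products `P_{x,x,a}/P_{x-1,x-1,a}`. -/
theorem claim_P_ratio (x a : ℕ) (hx : 1 ≤ x) :
    Pf x x a / Pf (x - 1) (x - 1) a =
      (((a : ℝ) + x) / x) * (((2 * a + 2 * x - 1)! : ℝ) / ((2 * a + x)! : ℝ)) *
        ((x ! : ℝ) / ((2 * x - 1)! : ℝ)) := by
  obtain ⟨k, rfl⟩ : ∃ k, x = k + 1 := ⟨x - 1, by omega⟩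
  have key : Pf (k + 1) (k + 1) a = Pf k k a *
      ((((a : ℝ) + (k + 1 : ℕ)) / (k + 1 : ℕ)) *
        ∏ j ∈ Finset.Icc 2 (k + 1),
          ((2 * a + (k + 1) + j - 1 : ℕ) : ℝ) / (((k + 1) + j - 1 : ℕ) : ℝ)) := by
    unfold Pf
    rw [Finset.prod_Icc_succ_top (by omega)]
    simp
  rw [Nat.add_sub_cancel, key, mul_div_cancel_left₀ _ (aux_pos k a), aux_prod, mul_assoc]
  have e1 : 2 * a + 2 * (k + 1) - 1 = 2 * a + (k + 1) + k := by omega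
  have e2 : 2 * (k + 1) - 1 = k + 1 + k := by omega
  rw [e1, e2]
end

section
/- For every real number x > 2m and all integers n ≥ 0 and m ≥ 0, one has T(x,n,m) · (x-1)_m = T(x-1,n,m) · (x+n-m)_m, i.e. T(x,n,m)/T(x-1,n,m) = (x+n-m)_m/(x-1)_m. -/
open Finset Nat

/-- Shifting the base of a Pochhammer symbol by one. -/
theorem poch_shift (q : ℝ) (k : ℤ) (h : 0 < q + k - 1) :
    poch q k * (q - 1) = poch (q - 1) k * (q + k - 1) := by
  unfold poch
  split_ifs with hk
  · obtain ⟨j, rfl⟩ := Int.eq_ofNat_of_zero_le hk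
    have h1 := Finset.prod_range_succ (fun i : ℕ => q - 1 + (i : ℝ)) j
    have h2 := Finset.prod_range_succ' (fun i : ℕ => q - 1 + (i : ℝ)) j
    have h3 : ∏ i ∈ Finset.range j, (q - 1 + ((i + 1 : ℕ) : ℝ))
        = ∏ i ∈ Finset.range j, (q + (i : ℝ)) :=
      Finset.prod_congr rfl (fun i _ => by push_cast; ring)
    rw [h3, h1] at h2
    simp only [Int.toNat_natCast, Int.cast_natCast]
    push_cast at h2
    linear_combination -h2
  · obtain ⟨j, hj⟩ := Int.eq_ofNat_of_zero_le (show 0 ≤ -k by omega)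
    obtain rfl : k = -(j : ℤ) := by omega
    push_cast at h
    have h1 := Finset.prod_range_succ (fun i : ℕ => q - ((i : ℝ) + 1)) j
    have h2 := Finset.prod_range_succ' (fun i : ℕ => q - ((i : ℝ) + 1)) j
    have h3 : ∏ i ∈ Finset.range j, (q - (((i + 1 : ℕ) : ℝ) + 1))
        = ∏ i ∈ Finset.range j, (q - 1 - ((i : ℝ) + 1)) :=
      Finset.prod_congr rfl (fun i _ => by push_cast; ring)
    rw [h3, h1] at h2
    have n1 : ∏ i ∈ Finset.range j, (q - ((i : ℝ) + 1)) ≠ 0 := by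
      refine Finset.prod_ne_zero_iff.2 (fun i hi => ?_)
      have : (i : ℝ) + 1 ≤ j := by exact_mod_cast Finset.mem_range.1 hi
      apply ne_of_gt; linarith
    have n2 : ∏ i ∈ Finset.range j, (q - 1 - ((i : ℝ) + 1)) ≠ 0 := by
      refine Finset.prod_ne_zero_iff.2 (fun i hi => ?_)
      have : (i : ℝ) + 1 ≤ j := by exact_mod_cast Finset.mem_range.1 hi
      apply ne_of_gt; linarith
    simp only [neg_neg, Int.toNat_natCast, Int.cast_neg, Int.cast_natCast]
    rw [div_mul_eq_mul_div, div_mul_eq_mul_div, div_eq_div_iff n1 n2]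
    push_cast at h2
    linear_combination -h2

/-- `T(x,n,m)·(x-1)_m = T(x-1,n,m)·(x+n-m)_m`. -/
theorem claim_T_shift (x : ℝ) (n m : ℤ) (hn : 0 ≤ n) (hm : 0 ≤ m)
    (hx : 2 * (m : ℝ) < x) :
    trapT x n m * poch (x - 1) m = trapT (x - 1) n m * poch (x + n - m) m := by
  obtain ⟨m, rfl⟩ := Int.eq_ofNat_of_zero_le hm
  have hn' : (0 : ℝ) ≤ n := by exact_mod_cast hn
  have e1 : poch (x - 1) (m : ℤ) = ∏ i ∈ Finset.range m, (x + (i : ℝ) - 1) := by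
    unfold poch
    rw [if_pos hm, Int.toNat_natCast]
    exact Finset.prod_congr rfl (fun i _ => by ring)
  have e2 : poch (x + n - (m : ℤ)) (m : ℤ)
      = ∏ i ∈ Finset.range m, (x + (i : ℝ) + ((n - 2 * (i : ℤ) : ℤ) : ℝ) - 1) := by
    unfold poch
    rw [if_pos hm, Int.toNat_natCast, ← Finset.prod_range_reflect]
    refine Finset.prod_congr rfl (fun i hi => ?_)
    have hi' := Finset.mem_range.1 hi
    rw [Nat.cast_sub (by omega), Nat.cast_sub (by omega)]
    push_cast
    ring
  rw [e1, e2]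
  unfold trapT
  rw [Int.toNat_natCast, ← Finset.prod_mul_distrib, ← Finset.prod_mul_distrib]
  refine Finset.prod_congr rfl (fun i hi => ?_)
  have hi' : (i : ℝ) + 1 ≤ m := by exact_mod_cast Finset.mem_range.1 hi
  have h0 : (0 : ℝ) ≤ i := Nat.cast_nonneg i
  push_cast at hx
  rw [poch_shift (x + i) (n - 2 * (i : ℤ)) (by push_cast; linarith),
    show x + (i : ℝ) - 1 = x - 1 + i by ring]
end

section
/- For every real number x > 2m and all integers n ≥ 0 and m ≥ 0, one has V(x,n,m) · [x-2]_m = V(x-2,n,m) · [x+2n-2m]_m, i.e. V(x,n,m)/V(x-2,n,m) = [x+2n-2m]_m/[x-2]_m. -/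
open Finset Nat

lemma prod_shift' (q d : ℝ) (p : ℕ) :
    (∏ i ∈ Finset.range p, (q + d * (i + 1))) * (q + d * (p + 1)) =
      (q + d) * ∏ i ∈ Finset.range p, (q + d + d * (i + 1)) := by
  induction p with
  | zero => simp
  | succ p ih =>
    rw [Finset.prod_range_succ, Finset.prod_range_succ]
    push_cast
    linear_combination (q + d * (p + 1 + 1)) * ih

lemma spoch_shift (q : ℝ) (k : ℤ) (h1 : q - 2 ≠ 0) (h2 : q - 2 + 2 * k ≠ 0) :
    spoch q k * (q - 2) = spoch (q - 2) k * (q - 2 + 2 * k) := by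
  unfold spoch
  split_ifs with hk
  · obtain ⟨p, rfl⟩ := Int.eq_ofNat_of_zero_le hk
    have h := prod_shift' (q - 4) 2 p
    have e1 : ∏ i ∈ Finset.range p, (q - 4 + 2 * ((i : ℝ) + 1)) =
        ∏ i ∈ Finset.range p, (q - 2 + 2 * (i : ℝ)) :=
      Finset.prod_congr rfl fun i _ => by ring
    have e2 : ∏ i ∈ Finset.range p, (q - 4 + 2 + 2 * ((i : ℝ) + 1)) =
        ∏ i ∈ Finset.range p, (q + 2 * (i : ℝ)) :=
      Finset.prod_congr rfl fun i _ => by ring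
    rw [e1, e2] at h
    simp only [Int.toNat_natCast, Int.cast_natCast]
    linear_combination -h
  · obtain ⟨p, hp⟩ := Int.eq_ofNat_of_zero_le (show 0 ≤ -k by omega)
    obtain rfl : k = -(p : ℤ) := by omega
    have h := prod_shift' q (-2) p
    have e1 : ∏ i ∈ Finset.range p, (q + -2 * ((i : ℝ) + 1)) =
        ∏ i ∈ Finset.range p, (q - 2 * ((i : ℝ) + 1)) :=
      Finset.prod_congr rfl fun i _ => by ring
    have e2 : ∏ i ∈ Finset.range p, (q + -2 + -2 * ((i : ℝ) + 1)) =
        ∏ i ∈ Finset.range p, (q - 2 - 2 * ((i : ℝ) + 1)) :=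
      Finset.prod_congr rfl fun i _ => by ring
    rw [e1, e2] at h
    simp only [neg_neg, Int.toNat_natCast, Int.cast_neg, Int.cast_natCast] at h2 ⊢
    generalize ∏ i ∈ Finset.range p, (q - 2 * ((i : ℝ) + 1)) = A at h ⊢
    generalize ∏ i ∈ Finset.range p, (q - 2 - 2 * ((i : ℝ) + 1)) = B at h ⊢
    have h' : A * (q - 2 + 2 * -(p : ℝ)) = (q - 2) * B := by linear_combination h
    by_cases hA : A = 0
    · have hB : B = 0 := by
        rw [hA, zero_mul] at h'
        exact (mul_eq_zero.mp h'.symm).resolve_left h1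
      simp [hA, hB]
    · have hB : B ≠ 0 := by
        rintro rfl
        rw [mul_zero] at h'
        exact (mul_ne_zero hA h2) h'
      rw [one_div_mul_eq_div, one_div_mul_eq_div, div_eq_div_iff hA hB]
      linear_combination -h'

/-- `V(x,n,m)·[x-2]_m = V(x-2,n,m)·[x+2n-2m]_m`. -/
theorem claim_V_shift (x : ℝ) (n m : ℤ) (hn : 0 ≤ n) (hm : 0 ≤ m)
    (hx : 2 * (m : ℝ) < x) :
    trapV x n m * spoch (x - 2) m = trapV (x - 2) n m * spoch (x + 2 * n - 2 * m) m := by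
  obtain ⟨m, rfl⟩ := Int.eq_ofNat_of_zero_le hm
  have hn' : (0 : ℝ) ≤ n := by exact_mod_cast hn
  rw [Int.cast_natCast] at hx
  have s1 : spoch (x - 2) (m : ℤ) = ∏ i ∈ Finset.range m, (x + 2 * (i : ℝ) - 2) := by
    unfold spoch
    rw [if_pos hm, Int.toNat_natCast]
    exact Finset.prod_congr rfl fun i _ => by ring
  have s2 : spoch (x + 2 * n - 2 * ((m : ℤ) : ℝ)) (m : ℤ) =
      ∏ i ∈ Finset.range m, (x + 2 * (i : ℝ) - 2 + 2 * ((n - 2 * (i : ℤ) : ℤ) : ℝ)) := by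
    unfold spoch
    rw [if_pos hm, Int.toNat_natCast, ← Finset.prod_range_reflect]
    refine Finset.prod_congr rfl fun i hi => ?_
    have hi' := Finset.mem_range.mp hi
    have : ((m - 1 - i : ℕ) : ℝ) = m - 1 - i := by
      rw [Nat.sub_sub, Nat.cast_sub (by omega)]
      push_cast
      ring
    rw [this]
    push_cast
    ring
  rw [s1, s2]
  unfold trapV
  rw [Int.toNat_natCast, ← Finset.prod_mul_distrib, ← Finset.prod_mul_distrib]
  refine Finset.prod_congr rfl fun i hi => ?_
  have hi' : (i : ℝ) + 1 ≤ m := by exact_mod_cast Finset.mem_range.mp hi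
  have hi0 : (0 : ℝ) ≤ i := Nat.cast_nonneg i
  have key := spoch_shift (x + 2 * i) (n - 2 * i) (by linarith)
    (by push_cast; intro h; linarith)
  rw [show x - 2 + 2 * (i : ℝ) = x + 2 * i - 2 by ring]
  exact key
end

section
/- Let t = (t_1,…,t_{2l}) be a sequence of nonnegative integers and let t' = (t_1,…,t_{2l-1}, t_{2l}+1) be the sequence obtained by increasing the last entry by 1. Then Q(t')/Q(t) = (s_{2l}(t)+1) · (2 s_{2l}(t)+1)! / (2E(t)+1)! · ∏_{i=1}^{l} (s_{2l}(t) - s_{2i-1}(t))! / (s_{2l}(t) + s_{2i-1}(t) + 1)! · ∏_{i=1}^{l-1} (s_{2l}(t) + s_{2i}(t) + 1)! / (s_{2l}(t) - s_{2i}(t))!, where all partial sums s_k and E refer to the original sequence t. -/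
open Finset Nat

lemma hyperfac_succ_aux (n : ℕ) : (hyperfac (n + 1) : ℝ) = hyperfac n * (n ! : ℝ) := by
  unfold hyperfac
  rw [Finset.prod_range_succ]
  push_cast
  rfl

lemma hyperfac_ne_aux (n : ℕ) : (hyperfac n : ℝ) ≠ 0 := by
  unfold hyperfac
  rw [Nat.cast_ne_zero, Finset.prod_ne_zero_iff]
  intro i _
  exact Nat.factorial_ne_zero i

lemma hyperfac2_ne_aux (n : ℕ) : (hyperfac2 n : ℝ) ≠ 0 := by
  unfold hyperfac2
  rw [Nat.cast_ne_zero, Finset.prod_ne_zero_iff]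
  intro i _
  split_ifs <;> exact Nat.factorial_ne_zero _

lemma hyperfac2_succ_aux (n : ℕ) :
    (hyperfac2 (2 * (n + 1) + 1) : ℝ) = hyperfac2 (2 * n + 1) * ((2 * n + 1)! : ℝ) := by
  unfold hyperfac2
  have h1 : (2 * (n + 1) + 1) / 2 = n + 1 := by omega
  have h2 : (2 * n + 1) / 2 = n := by omega
  have h3 : (2 * (n + 1) + 1) % 2 = 1 := by omega
  have h4 : (2 * n + 1) % 2 = 1 := by omega
  rw [h1, h2, h3, h4, Finset.prod_range_succ]
  push_cast
  simp

lemma pSum_update_lt_aux (t : ℕ → ℕ) (m v k : ℕ) (h : k < m) :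
    pSum (Function.update t m v) k = pSum t k := by
  unfold pSum
  refine Finset.sum_congr rfl fun i hi => ?_
  rw [Finset.mem_Icc] at hi
  exact Function.update_of_ne (by omega) _ _

lemma pSum_update_self_aux (t : ℕ → ℕ) (m : ℕ) (h : 1 ≤ m) :
    pSum (Function.update t m (t m + 1)) m = pSum t m + 1 := by
  obtain ⟨n, rfl⟩ : ∃ n, m = n + 1 := ⟨m - 1, by omega⟩
  have h1 := pSum_update_lt_aux t (n + 1) (t (n + 1) + 1) n (by omega)
  unfold pSum at *
  rw [Finset.sum_Icc_succ_top (by omega), Finset.sum_Icc_succ_top (by omega), h1]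
  simp
  omega

lemma pSum_mono_aux (t : ℕ → ℕ) {a b : ℕ} (h : a ≤ b) : pSum t a ≤ pSum t b :=
  Finset.sum_le_sum_of_subset (Finset.Icc_subset_Icc_right h)

lemma evenSum_update_aux (t : ℕ → ℕ) (l : ℕ) (h : 1 ≤ l) :
    evenSum l (Function.update t (2 * l) (t (2 * l) + 1)) = evenSum l t + 1 := by
  obtain ⟨n, rfl⟩ : ∃ n, l = n + 1 := ⟨l - 1, by omega⟩
  unfold evenSum
  rw [Finset.sum_Icc_succ_top (by omega), Finset.sum_Icc_succ_top (by omega)]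
  have : ∑ i ∈ Finset.Icc 1 n,
      Function.update t (2 * (n + 1)) (t (2 * (n + 1)) + 1) (2 * i) =
      ∑ i ∈ Finset.Icc 1 n, t (2 * i) := by
    refine Finset.sum_congr rfl fun i hi => ?_
    rw [Finset.mem_Icc] at hi
    exact Function.update_of_ne (by omega) _ _
  rw [this]
  simp
  omega

/-- A product over `1..l` in which only the last factor changes. -/
lemma prod_last_aux (l : ℕ) (hl : 1 ≤ l) (f g : ℕ → ℝ) (c : ℝ)
    (h : ∀ i, i < l → f i = g i) (hc : f l = g l * c) :
    ∏ i ∈ Finset.Icc 1 l, f i = (∏ i ∈ Finset.Icc 1 l, g i) * c := by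
  obtain ⟨n, rfl⟩ : ∃ n, l = n + 1 := ⟨l - 1, by omega⟩
  rw [Finset.prod_Icc_succ_top (by omega), Finset.prod_Icc_succ_top (by omega), hc, mul_assoc]
  congr 1
  refine Finset.prod_congr rfl fun i hi => ?_
  rw [Finset.mem_Icc] at hi
  exact h i (by omega)

/-- A product over pairs in which only the factors with second entry `2 * l` change. -/
lemma prod_pairs_aux (l r : ℕ) (f g : ℕ × ℕ → ℝ) (c : ℕ → ℝ)
    (h : ∀ p : ℕ × ℕ, p.1 < p.2 → p.2 < 2 * l → f p = g p)
    (hc : ∀ i, i < 2 * l → f (i, 2 * l) = g (i, 2 * l) * c i) :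
    ∏ p ∈ (Finset.Icc 1 (2 * l) ×ˢ Finset.Icc 1 (2 * l)).filter
        (fun p => p.1 < p.2 ∧ (p.2 - p.1) % 2 = r), f p =
    (∏ p ∈ (Finset.Icc 1 (2 * l) ×ˢ Finset.Icc 1 (2 * l)).filter
        (fun p => p.1 < p.2 ∧ (p.2 - p.1) % 2 = r), g p) *
      ∏ i ∈ (Finset.Icc 1 (2 * l)).filter (fun i => i < 2 * l ∧ (2 * l - i) % 2 = r), c i := by
  have h1 : ∏ i ∈ (Finset.Icc 1 (2 * l)).filter
      (fun i => i < 2 * l ∧ (2 * l - i) % 2 = r), c i =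
      ∏ p ∈ (Finset.Icc 1 (2 * l) ×ˢ Finset.Icc 1 (2 * l)).filter
        (fun p => p.1 < p.2 ∧ (p.2 - p.1) % 2 = r), if p.2 = 2 * l then c p.1 else 1 := by
    rw [← Finset.prod_filter]
    refine Finset.prod_bij' (fun i _ => (i, 2 * l)) (fun p _ => p.1) ?_ ?_ ?_ ?_ ?_
    · intro i hi
      simp only [Finset.mem_filter, Finset.mem_product, Finset.mem_Icc] at *
      exact ⟨⟨⟨hi.1, by omega, le_rfl⟩, hi.2⟩, trivial⟩
    · rintro ⟨a, b⟩ hi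
      simp only [Finset.mem_filter, Finset.mem_product, Finset.mem_Icc] at *
      obtain ⟨⟨h1, h2, h3⟩, rfl⟩ := hi
      omega
    · intro i hi
      rfl
    · rintro ⟨a, b⟩ hi
      simp only [Finset.mem_filter] at *
      rw [hi.2]
    · intro i hi
      rfl
  rw [h1, ← Finset.prod_mul_distrib]
  refine Finset.prod_congr rfl ?_
  rintro ⟨a, b⟩ hp
  simp only [Finset.mem_filter, Finset.mem_product, Finset.mem_Icc] at hp
  by_cases hb : b = 2 * l
  · subst hb
    simpa using hc a hp.2.1
  · simpa [hb] using h (a, b) hp.2.1 (by simp only; omega)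

lemma prod_odd_aux (l : ℕ) (c : ℕ → ℝ) :
    ∏ i ∈ (Finset.Icc 1 (2 * l)).filter (fun i => i < 2 * l ∧ (2 * l - i) % 2 = 1), c i =
      ∏ i ∈ Finset.Icc 1 l, c (2 * i - 1) := by
  refine Finset.prod_bij' (fun i _ => (i + 1) / 2) (fun i _ => 2 * i - 1) ?_ ?_ ?_ ?_ ?_
  all_goals intro i hi
  all_goals simp only [Finset.mem_filter, Finset.mem_Icc] at *
  · omega
  · omega
  · omega
  · omega
  · congr 1
    omega

lemma prod_even_aux (l : ℕ) (c : ℕ → ℝ) :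
    ∏ i ∈ (Finset.Icc 1 (2 * l)).filter (fun i => i < 2 * l ∧ (2 * l - i) % 2 = 0), c i =
      ∏ i ∈ Finset.Icc 1 (l - 1), c (2 * i) := by
  refine Finset.prod_bij' (fun i _ => i / 2) (fun i _ => 2 * i) ?_ ?_ ?_ ?_ ?_
  all_goals intro i hi
  all_goals simp only [Finset.mem_filter, Finset.mem_Icc] at *
  · omega
  · omega
  · omega
  · omega
  · congr 1
    omega

lemma Qfun_ne_aux (l : ℕ) (t : ℕ → ℕ) : Qfun l t ≠ 0 := by
  unfold Qfun
  have hf : ∀ n : ℕ, (n ! : ℝ) ≠ 0 := fun n => Nat.cast_ne_zero.2 (Nat.factorial_ne_zero n)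
  refine mul_ne_zero (mul_ne_zero (mul_ne_zero (div_ne_zero ?_ (hyperfac2_ne_aux _)) ?_) ?_) ?_
  all_goals refine Finset.prod_ne_zero_iff.2 fun i _ => ?_
  · exact div_ne_zero (hf _) (hf _)
  · exact div_ne_zero (mul_ne_zero (hyperfac2_ne_aux _) (hyperfac_ne_aux _)) (hyperfac2_ne_aux _)
  · exact div_ne_zero (hyperfac_ne_aux _) (hyperfac_ne_aux _)
  · exact div_ne_zero (hyperfac_ne_aux _) (hyperfac_ne_aux _)

/-- ratio `Q(t')/Q(t)` where `t'` increases the last entry of `t` by one. -/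
theorem claim_Q_last_ratio (l : ℕ) (hl : 1 ≤ l) (t : ℕ → ℕ) :
    Qfun l (Function.update t (2 * l) (t (2 * l) + 1)) / Qfun l t =
      ((pSum t (2 * l) : ℝ) + 1) * ((2 * pSum t (2 * l) + 1)! : ℝ) /
          ((2 * evenSum l t + 1)! : ℝ) *
        (∏ i ∈ Finset.Icc 1 l,
          ((pSum t (2 * l) - pSum t (2 * i - 1))! : ℝ) /
            ((pSum t (2 * l) + pSum t (2 * i - 1) + 1)! : ℝ)) *
        (∏ i ∈ Finset.Icc 1 (l - 1),
          ((pSum t (2 * l) + pSum t (2 * i) + 1)! : ℝ) /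
            ((pSum t (2 * l) - pSum t (2 * i))! : ℝ)) := by
  rw [div_eq_iff (Qfun_ne_aux l t)]
  have hlt := pSum_update_lt_aux t (2 * l) (t (2 * l) + 1)
  have hself := pSum_update_self_aux t (2 * l) (by omega)
  have hE := evenSum_update_aux t l hl
  generalize Function.update t (2 * l) (t (2 * l) + 1) = t' at *
  unfold Qfun
  have hsub : ∀ i, i < 2 * l → pSum t (2 * l) + 1 - pSum t i = pSum t (2 * l) - pSum t i + 1 := by
    intro i hi
    have := pSum_mono_aux t hi.le
    omega
  have hadd : ∀ i, pSum t (2 * l) + 1 + pSum t i + 1 = (pSum t (2 * l) + pSum t i + 1) + 1 := by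
    intro i
    omega
  rw [prod_last_aux l hl (fun i => ((pSum t' (2 * i))! : ℝ) / ((pSum t' (2 * i - 1))! : ℝ))
    (fun i => ((pSum t (2 * i))! : ℝ) / ((pSum t (2 * i - 1))! : ℝ)) ((pSum t (2 * l) : ℝ) + 1)
    (fun i hi => by simp only [hlt (2 * i) (by omega), hlt (2 * i - 1) (by omega)])
    (by
      simp only [hself, hlt (2 * l - 1) (by omega), Nat.factorial_succ]
      push_cast
      ring)]
  rw [prod_last_aux l hl
    (fun i => ((hyperfac2 (2 * pSum t' (2 * i) + 1) : ℝ) *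
      (hyperfac (2 * pSum t' (2 * i - 1) + 2) : ℝ)) /
        (hyperfac2 (2 * pSum t' (2 * i - 1) + 3) : ℝ))
    (fun i => ((hyperfac2 (2 * pSum t (2 * i) + 1) : ℝ) *
      (hyperfac (2 * pSum t (2 * i - 1) + 2) : ℝ)) /
        (hyperfac2 (2 * pSum t (2 * i - 1) + 3) : ℝ)) ((2 * pSum t (2 * l) + 1)! : ℝ)
    (fun i hi => by simp only [hlt (2 * i) (by omega), hlt (2 * i - 1) (by omega)])
    (by
      simp only [hself, hlt (2 * l - 1) (by omega), hyperfac2_succ_aux]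
      ring)]
  rw [prod_pairs_aux l 1
    (fun p => (hyperfac (pSum t' p.2 - pSum t' p.1) : ℝ) /
      (hyperfac (pSum t' p.2 + pSum t' p.1 + 1) : ℝ))
    (fun p => (hyperfac (pSum t p.2 - pSum t p.1) : ℝ) /
      (hyperfac (pSum t p.2 + pSum t p.1 + 1) : ℝ))
    (fun i => ((pSum t (2 * l) - pSum t i)! : ℝ) / ((pSum t (2 * l) + pSum t i + 1)! : ℝ))
    (fun p h1 h2 => by simp only [hlt p.1 (by omega), hlt p.2 h2])
    (fun i hi => by
      simp only [hself, hlt i hi, hsub i hi, hadd i, hyperfac_succ_aux]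
      rw [mul_div_mul_comm])]
  rw [prod_pairs_aux l 0
    (fun p => (hyperfac (pSum t' p.2 + pSum t' p.1 + 1) : ℝ) /
      (hyperfac (pSum t' p.2 - pSum t' p.1) : ℝ))
    (fun p => (hyperfac (pSum t p.2 + pSum t p.1 + 1) : ℝ) /
      (hyperfac (pSum t p.2 - pSum t p.1) : ℝ))
    (fun i => ((pSum t (2 * l) + pSum t i + 1)! : ℝ) / ((pSum t (2 * l) - pSum t i)! : ℝ))
    (fun p h1 h2 => by simp only [hlt p.1 (by omega), hlt p.2 h2])
    (fun i hi => by
      simp only [hself, hlt i hi, hsub i hi]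
      rw [hadd i, hyperfac_succ_aux (pSum t (2 * l) + pSum t i + 1),
        hyperfac_succ_aux (pSum t (2 * l) - pSum t i), mul_div_mul_comm])]
  rw [prod_odd_aux, prod_even_aux, hE, hyperfac2_succ_aux]
  ring
end

section
/- For all integers x, y, z ≥ 1 and a, b ≥ 1, the explicit product φ_{x,y,z}(a,b) satisfies the Kuo condensation recurrence φ_{x,y,z}(a,b) · φ_{x,y-1,z-1}(a,b) = φ_{x,y-1,z}(a,b) · φ_{x,y,z-1}(a,b) + φ_{x+1,y-1,z-1}(a,b) · φ_{x-1,y,z}(a,b). -/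
open Finset Nat

/-- Real valued hyperfactorial. -/
noncomputable def hR (n : ℕ) : ℝ := (hyperfac n : ℝ)

/-- Real valued `H₂(2m+1)`. -/
noncomputable def kR (m : ℕ) : ℝ := (hyperfac2 (2 * m + 1) : ℝ)

/-- Real valued factorial. -/
noncomputable def fR (m : ℕ) : ℝ := (m ! : ℝ)

lemma fR_ne (n : ℕ) : fR n ≠ 0 := by
  unfold fR; exact_mod_cast Nat.factorial_ne_zero n

lemma fR_succ (n : ℕ) : fR (n + 1) = ((n : ℝ) + 1) * fR n := by
  unfold fR; rw [Nat.factorial_succ]; push_cast; ring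

lemma hR_ne (n : ℕ) : hR n ≠ 0 := by
  unfold hR hyperfac
  exact_mod_cast Finset.prod_ne_zero_iff.mpr (fun i _ => Nat.factorial_ne_zero i)

lemma hR_succ (n : ℕ) : hR (n + 1) = hR n * fR n := by
  unfold hR hyperfac fR; rw [Finset.prod_range_succ]; push_cast; ring

lemma kR_eq (m : ℕ) : kR m = ∏ i ∈ Finset.range m, fR (2 * i + 1) := by
  unfold kR hyperfac2 fR
  have h1 : (2 * m + 1) / 2 = m := by omega
  have h2 : ¬ ((2 * m + 1) % 2 = 0) := by omega
  rw [h1]; simp only [h2, if_false]; push_cast; rfl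

lemma kR_ne (n : ℕ) : kR n ≠ 0 := by
  rw [kR_eq]; exact Finset.prod_ne_zero_iff.mpr (fun i _ => fR_ne _)

lemma kR_succ (n : ℕ) : kR (n + 1) = kR n * fR (2 * n + 1) := by
  rw [kR_eq, kR_eq, Finset.prod_range_succ]

lemma asc_prod (k n : ℕ) : (∏ i ∈ Finset.range n, ((k : ℝ) + 1 + i)) * fR k = fR (k + n) := by
  induction n with
  | zero => simp
  | succ n ih =>
    rw [Finset.prod_range_succ, ← add_assoc, fR_succ, ← ih]; push_cast; ring

lemma desc_prod (l m : ℕ) :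
    (∏ i ∈ Finset.range m, ((l : ℝ) + m + 1 - ((i : ℝ) + 1))) * fR l = fR (l + m) := by
  induction m with
  | zero => simp
  | succ m ih =>
    rw [Finset.prod_range_succ', ← add_assoc, fR_succ, ← ih]
    have : ∀ i : ℕ, ((l : ℝ) + ((m + 1 : ℕ) : ℝ) + 1 - (((i + 1 : ℕ) : ℝ) + 1))
        = (l : ℝ) + m + 1 - ((i : ℝ) + 1) := by
      intro i; push_cast; ring
    simp only [this]
    push_cast; ring

lemma poch_eq (k l : ℕ) (n : ℤ) (h : (k : ℤ) + n = l) :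
    poch ((k : ℝ) + 1) n = fR l / fR k := by
  unfold poch
  split_ifs with hn
  · obtain ⟨m, rfl⟩ := Int.eq_ofNat_of_zero_le hn
    have : l = k + m := by omega
    subst this
    rw [← asc_prod]
    simp only [Int.toNat_natCast]
    field_simp [fR_ne]
  · obtain ⟨m, hm⟩ := Int.eq_ofNat_of_zero_le (show 0 ≤ -n by omega)
    have : k = l + m := by omega
    subst this
    rw [hm]
    have h1 := desc_prod l m
    have h2 : (∏ i ∈ Finset.range m, ((l : ℝ) + m + 1 - ((i : ℝ) + 1))) ≠ 0 := by
      intro h0; rw [h0, zero_mul] at h1; exact fR_ne _ h1.symm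
    rw [← h1]
    simp only [Int.toNat_natCast]
    push_cast
    field_simp [fR_ne]

lemma hR_add (p m : ℕ) : hR (p + m) = hR p * ∏ i ∈ Finset.range m, fR (p + i) := by
  induction m with
  | zero => simp
  | succ m ih => rw [← add_assoc, hR_succ, ih, Finset.prod_range_succ]; ring

lemma trapT_eq (p y m : ℕ) (q : ℝ) (hq : q = (p : ℝ) + 1) :
    trapT q ((y : ℤ) + m - 1) m = hR (p + y + m) * hR p / (hR (p + y) * hR (p + m)) := by
  subst hq
  unfold trapT
  have h1 : ∀ i ∈ Finset.range (m : ℤ).toNat,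
      poch ((p : ℝ) + 1 + i) ((y : ℤ) + m - 1 - 2 * i)
        = fR (p + y + (m - 1 - i)) / fR (p + i) := by
    intro i hi
    have hi' : i < m := by simpa using hi
    rw [← poch_eq (p + i) (p + y + (m - 1 - i)) ((y : ℤ) + m - 1 - 2 * i) (by omega)]
    push_cast
    congr 1; ring
  rw [Finset.prod_congr rfl h1, Finset.prod_div_distrib, Int.toNat_natCast,
    Finset.prod_range_reflect (fun i => fR (p + y + i)), hR_add (p + y) m, hR_add p m]
  have h3 : (∏ i ∈ Finset.range m, fR (p + i)) ≠ 0 :=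
    Finset.prod_ne_zero_iff.mpr (fun i _ => fR_ne _)
  field_simp [hR_ne]

/-- The factor depending on the first two entries of `Q` only. -/
noncomputable def Qc (a b : ℕ) : ℝ :=
  fR (a + b) / fR a * (kR (a + b) * hR (2 * a + 2) / kR (a + 1)) * (hR b / hR (2 * a + b + 1))

lemma Q4_eq (a b x n : ℕ) : Q4 a b x n = Qc a b *
    (fR (x + n + a + b) / fR (x + a + b) / kR (n + b)) *
    (kR (x + n + a + b) * hR (2 * (x + a + b) + 2) / kR (x + a + b + 1)) *
    (hR (x + n + b) / hR (x + n + 2 * a + b + 1)) *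
    (hR x / hR (x + 2 * a + 2 * b + 1)) *
    (hR n / hR (2 * x + n + 2 * a + 2 * b + 1)) *
    (hR (x + 2 * a + b + 1) / hR (x + b)) *
    (hR (x + n + 2 * a + 2 * b + 1) / hR (x + n)) := by
  unfold Q4 Qfun
  have e1 : Finset.Icc 1 2 = {1, 2} := by decide
  have s1 : pSum (seqOf [a, b, x, n]) 1 = a := by
    simp [pSum, seqOf]
  have s2 : pSum (seqOf [a, b, x, n]) 2 = a + b := by
    simp [pSum, seqOf, Finset.sum_Icc_succ_top]
  have s3 : pSum (seqOf [a, b, x, n]) 3 = x + a + b := by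
    simp [pSum, seqOf, Finset.sum_Icc_succ_top]; ring
  have s4 : pSum (seqOf [a, b, x, n]) 4 = x + n + a + b := by
    simp [pSum, seqOf, Finset.sum_Icc_succ_top]; ring
  have e : evenSum 2 (seqOf [a, b, x, n]) = n + b := by
    simp [evenSum, seqOf, Finset.sum_Icc_succ_top]; ring
  have p1 : (Finset.Icc 1 (2 * 2) ×ˢ Finset.Icc 1 (2 * 2)).filter
        (fun p : ℕ × ℕ => p.1 < p.2 ∧ (p.2 - p.1) % 2 = 1)
        = {(1, 2), (1, 4), (2, 3), (3, 4)} := by decide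
  have p2 : (Finset.Icc 1 (2 * 2) ×ˢ Finset.Icc 1 (2 * 2)).filter
        (fun p : ℕ × ℕ => p.1 < p.2 ∧ (p.2 - p.1) % 2 = 0)
        = {(1, 3), (2, 4)} := by decide
  rw [p1, p2, e1, e]
  rw [Finset.prod_pair (by decide), Finset.prod_pair (by decide), Finset.prod_pair (by decide)]
  rw [Finset.prod_insert (by decide), Finset.prod_insert (by decide),
    Finset.prod_pair (by decide)]
  norm_num only [s1, s2, s3, s4]
  unfold Qc hR kR fR
  rw [show a + b - a = b by omega, show x + n + a + b - a = x + n + b by omega,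
    show x + a + b - (a + b) = x by omega, show x + n + a + b - (x + a + b) = n by omega,
    show x + a + b - a = x + b by omega, show x + n + a + b - (a + b) = x + n by omega,
    show a + b + a + 1 = 2 * a + b + 1 by ring,
    show x + n + a + b + a + 1 = x + n + 2 * a + b + 1 by ring,
    show x + a + b + (a + b) + 1 = x + 2 * a + 2 * b + 1 by ring,
    show x + n + a + b + (x + a + b) + 1 = 2 * x + n + 2 * a + 2 * b + 1 by ring,
    show x + a + b + a + 1 = x + 2 * a + b + 1 by ring,
    show x + n + a + b + (a + b) + 1 = x + n + 2 * a + 2 * b + 1 by ring,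
    show 2 * (a + 1) + 1 = 2 * a + 3 by ring,
    show 2 * (x + a + b + 1) + 1 = 2 * (x + a + b) + 3 by ring]
  ring

lemma prod_shift (A N : ℕ) : (∏ j ∈ Finset.Icc 2 (N + 1), ((A + (N + 1) + j - 1 : ℕ) : ℝ))
    * fR (A + N + 1) = fR (A + 2 * N + 1) := by
  rw [show Finset.Icc 2 (N + 1) = Finset.Ico 2 (N + 2) by ext; simp; omega,
    Finset.prod_Ico_eq_prod_range]
  rw [show A + 2 * N + 1 = (A + N + 1) + N by ring, ← asc_prod (A + N + 1) N]
  congr 1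
  refine Finset.prod_congr rfl (fun i _ => ?_)
  rw [show A + (N + 1) + (2 + i) - 1 = A + N + 1 + 1 + i by omega]
  push_cast; ring

lemma Pf_succ (N c : ℕ) : Pf (N + 1) (N + 1) c = Pf N N c *
    (((c : ℝ) + N + 1) / (N + 1) *
      ((fR (2 * c + 2 * N + 1) / fR (2 * c + N + 1)) / (fR (2 * N + 1) / fR (N + 1)))) := by
  unfold Pf
  simp only [Nat.sub_self, zero_add, Finset.Icc_self, Finset.prod_singleton]
  rw [Finset.prod_Icc_succ_top (by omega)]
  congr 1
  have h1 := prod_shift (2 * c) N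
  have h2 := prod_shift 0 N
  simp only [zero_add] at h2
  rw [Finset.prod_div_distrib, ← h1, ← h2]
  have e1 : c + (N + 1) + 1 - 1 = c + N + 1 := by omega
  have e2 : N + 1 + 1 - 1 = N + 1 := by omega
  rw [e1, e2]
  push_cast
  congr 1
  field_simp [fR_ne]

lemma Pf_ne (N c : ℕ) : Pf N N c ≠ 0 := by
  induction N with
  | zero => simp [Pf]
  | succ N ih =>
    rw [Pf_succ]
    have := fR_ne
    have h1 : (c : ℝ) + N + 1 ≠ 0 := by positivity
    have h2 : (N : ℝ) + 1 ≠ 0 := by positivity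
    exact mul_ne_zero ih (mul_ne_zero (div_ne_zero h1 h2)
      (div_ne_zero (div_ne_zero (this _) (this _)) (div_ne_zero (this _) (this _))))

noncomputable def FF (a b x : ℕ) : ℝ :=
  hR x / hR (x + a + b) * hR (2 * (x + a + b) + 2) / (fR (x + a + b) * kR (x + a + b + 1))

noncomputable def GG (a b n : ℕ) : ℝ :=
  hR (n + b) * hR (n + a + b + 1) /
    (hR (n + 2 * a + b + 1) * kR (n + b) * Pf (n + b) (n + b) a)

noncomputable def WW (a b w : ℕ) : ℝ :=
  hR (w + 2 * a + 2 * b + 1) * fR (w + a + b) * kR (w + a + b) / hR (w + a + b + 1)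

noncomputable def LL (a b u : ℕ) : ℝ := 1 / hR (u + 2 * a + 2 * b + 1)

noncomputable def KK (a b y : ℕ) : ℝ :=
  Qc a b * Pf y (y + 2 * a) b * trapT (2 * (a : ℝ) + b + 2) ((y : ℤ) + b - 1) b /
    trapT ((b : ℝ) + 1) ((y : ℤ) + a - 1) a

noncomputable def ZZ (a b z : ℕ) : ℝ :=
  Pf (z + b) (z + b) a * (hR z / hR (z + b)) * (hR (z + 2 * a + b + 1) / hR (z + a + b + 1))

noncomputable def MM (a b v : ℕ) : ℝ :=
  hR (v + a + b) / hR (v + b) * (hR (v + 2 * a + b + 1) / hR (v + 2 * a + 2 * b + 1))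

noncomputable def NN (a b v : ℕ) : ℝ :=
  hR (v + a + b + 1) / hR (v + 2 * a + b + 1) * (hR (v + b) / hR v)

set_option maxHeartbeats 1000000 in
lemma phi_eq (x y z a b : ℕ) : phi x y z a b =
    KK a b y * ZZ a b z * MM a b (x + y) * NN a b (x + z) * FF a b x * GG a b (y + z) *
      WW a b (x + y + z) * LL a b (2 * x + y + z) := by
  unfold phi
  rw [Q4_eq, trapT_eq (x + b) y a ((x : ℝ) + b + 1) (by push_cast; ring),
    trapT_eq (x + z + a + b + 1) y a ((x : ℝ) + z + a + b + 2) (by push_cast; ring),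
    trapT_eq z y b ((z : ℝ) + 1) (by push_cast; ring),
    trapT_eq (z + a + b + 1) y a ((z : ℝ) + a + b + 2) (by push_cast; ring),
    trapT_eq (x + 2 * a + b + 1) y b ((x : ℝ) + 2 * a + b + 2) (by push_cast; ring),
    trapT_eq (x + z) y b ((x : ℝ) + z + 1) (by push_cast; ring)]
  unfold KK
  rw [show x + b + y + a = x + y + a + b by ring, show x + b + y = x + y + b by ring,
    show x + b + a = x + a + b by ring,
    show x + z + a + b + 1 + y + a = x + y + z + 2 * a + b + 1 by ring,
    show x + z + a + b + 1 + y = x + y + z + a + b + 1 by ring,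
    show x + z + a + b + 1 + a = x + z + 2 * a + b + 1 by ring,
    show z + y + b = y + z + b by ring, show z + y = y + z by ring,
    show z + a + b + 1 + y + a = y + z + 2 * a + b + 1 by ring,
    show z + a + b + 1 + y = y + z + a + b + 1 by ring,
    show z + a + b + 1 + a = z + 2 * a + b + 1 by ring,
    show x + 2 * a + b + 1 + y + b = x + y + 2 * a + 2 * b + 1 by ring,
    show x + 2 * a + b + 1 + y = x + y + 2 * a + b + 1 by ring,
    show x + 2 * a + b + 1 + b = x + 2 * a + 2 * b + 1 by ring,
    show x + z + y + b = x + y + z + b by ring,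
    show x + z + y = x + y + z by ring,
    ← add_assoc x y z, ← add_assoc (2 * x) y z]
  unfold ZZ MM NN FF GG WW LL
  have i1 := hR_ne
  have i2 := kR_ne
  have i3 := fR_ne
  have i4 := Pf_ne
  generalize trapT (2 * (a : ℝ) + b + 2) ((y : ℤ) + b - 1) b = t1
  generalize trapT ((b : ℝ) + 1) ((y : ℤ) + a - 1) a = t2
  generalize Qc a b = q
  generalize Pf y (y + 2 * a) b = p
  generalize (x + y + z : ℕ) = w
  generalize (2 * x + y + z : ℕ) = u
  generalize (y + z : ℕ) = n
  generalize (x + y : ℕ) = v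
  generalize (x + z : ℕ) = vv
  have g0 : hR (v + a + b) ≠ 0 := i1 _
  generalize hR (v + a + b) = r0 at g0 ⊢
  have g1 : hR (v + b) ≠ 0 := i1 _
  generalize hR (v + b) = r1 at g1 ⊢
  have g2 : hR (v + 2 * a + b + 1) ≠ 0 := i1 _
  generalize hR (v + 2 * a + b + 1) = r2 at g2 ⊢
  have g3 : hR (v + 2 * a + 2 * b + 1) ≠ 0 := i1 _
  generalize hR (v + 2 * a + 2 * b + 1) = r3 at g3 ⊢
  have g4 : hR (vv + a + b + 1) ≠ 0 := i1 _
  generalize hR (vv + a + b + 1) = r4 at g4 ⊢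
  have g5 : hR (vv + 2 * a + b + 1) ≠ 0 := i1 _
  generalize hR (vv + 2 * a + b + 1) = r5 at g5 ⊢
  have g6 : hR (vv + b) ≠ 0 := i1 _
  generalize hR (vv + b) = r6 at g6 ⊢
  have g7 : hR vv ≠ 0 := i1 _
  generalize hR vv = r7 at g7 ⊢
  have g8 : hR (x + a + b) ≠ 0 := i1 _
  generalize hR (x + a + b) = r8 at g8 ⊢
  have g9 : hR (2 * (x + a + b) + 2) ≠ 0 := i1 _
  generalize hR (2 * (x + a + b) + 2) = r9 at g9 ⊢
  have g10 : fR (x + a + b) ≠ 0 := i3 _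
  generalize fR (x + a + b) = r10 at g10 ⊢
  have g11 : kR (x + a + b + 1) ≠ 0 := i2 _
  generalize kR (x + a + b + 1) = r11 at g11 ⊢
  have g12 : hR (x + b) ≠ 0 := i1 _
  generalize hR (x + b) = r12 at g12 ⊢
  have g13 : hR (x + 2 * a + 2 * b + 1) ≠ 0 := i1 _
  generalize hR (x + 2 * a + 2 * b + 1) = r13 at g13 ⊢
  have g14 : hR (x + 2 * a + b + 1) ≠ 0 := i1 _
  generalize hR (x + 2 * a + b + 1) = r14 at g14 ⊢
  have g15 : hR x ≠ 0 := i1 _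
  generalize hR x = r15 at g15 ⊢
  have g16 : hR (n + b) ≠ 0 := i1 _
  generalize hR (n + b) = r16 at g16 ⊢
  have g17 : hR (n + a + b + 1) ≠ 0 := i1 _
  generalize hR (n + a + b + 1) = r17 at g17 ⊢
  have g18 : hR (n + 2 * a + b + 1) ≠ 0 := i1 _
  generalize hR (n + 2 * a + b + 1) = r18 at g18 ⊢
  have g19 : kR (n + b) ≠ 0 := i2 _
  generalize kR (n + b) = r19 at g19 ⊢
  have g20 : Pf (n + b) (n + b) a ≠ 0 := i4 _ _
  generalize Pf (n + b) (n + b) a = r20 at g20 ⊢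
  have g21 : hR n ≠ 0 := i1 _
  generalize hR n = r21 at g21 ⊢
  have g22 : hR (w + 2 * a + 2 * b + 1) ≠ 0 := i1 _
  generalize hR (w + 2 * a + 2 * b + 1) = r22 at g22 ⊢
  have g23 : hR (w + 2 * a + b + 1) ≠ 0 := i1 _
  generalize hR (w + 2 * a + b + 1) = r23 at g23 ⊢
  have g24 : hR (w + a + b + 1) ≠ 0 := i1 _
  generalize hR (w + a + b + 1) = r24 at g24 ⊢
  have g25 : hR (w + b) ≠ 0 := i1 _
  generalize hR (w + b) = r25 at g25 ⊢
  have g26 : hR w ≠ 0 := i1 _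
  generalize hR w = r26 at g26 ⊢
  have g27 : fR (w + a + b) ≠ 0 := i3 _
  generalize fR (w + a + b) = r27 at g27 ⊢
  have g28 : kR (w + a + b) ≠ 0 := i2 _
  generalize kR (w + a + b) = r28 at g28 ⊢
  have g29 : hR (u + 2 * a + 2 * b + 1) ≠ 0 := i1 _
  generalize hR (u + 2 * a + 2 * b + 1) = r29 at g29 ⊢
  have g30 : Pf (z + b) (z + b) a ≠ 0 := i4 _ _
  generalize Pf (z + b) (z + b) a = r30 at g30 ⊢
  have g31 : hR (z + b) ≠ 0 := i1 _
  generalize hR (z + b) = r31 at g31 ⊢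
  have g32 : hR z ≠ 0 := i1 _
  generalize hR z = r32 at g32 ⊢
  have g33 : hR (z + 2 * a + b + 1) ≠ 0 := i1 _
  generalize hR (z + 2 * a + b + 1) = r33 at g33 ⊢
  have g34 : hR (z + a + b + 1) ≠ 0 := i1 _
  generalize hR (z + a + b + 1) = r34 at g34 ⊢
  clear i1 i2 i3 i4
  rcases eq_or_ne t2 0 with ht | ht
  · simp [ht]
  field_simp

lemma h2 (n : ℕ) : hR (n + 2) * hR n = ((n : ℝ) + 1) * hR (n + 1) ^ 2 := by
  rw [hR_succ (n + 1), hR_succ n, fR_succ]; ring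

lemma LL_rec (a b u : ℕ) :
    LL a b (u + 2) * LL a b u * ((u : ℝ) + 2 * a + 2 * b + 2) = LL a b (u + 1) ^ 2 := by
  unfold LL
  have h := h2 (u + 2 * a + 2 * b + 1)
  rw [show u + 2 + 2 * a + 2 * b + 1 = u + 2 * a + 2 * b + 1 + 2 by ring,
    show u + 1 + 2 * a + 2 * b + 1 = u + 2 * a + 2 * b + 1 + 1 by ring]
  push_cast at h
  have i1 := hR_ne
  rw [_root_.div_mul_div_comm, h]
  have : (u : ℝ) + 2 * a + 2 * b + 1 + 1 ≠ 0 := by positivity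
  field_simp
  ring

lemma FF_rec (a b x : ℕ) :
    FF a b (x + 2) * FF a b x =
      2 * ((x : ℝ) + 1) * (2 * (x + 1 + a + b) + 1) * FF a b (x + 1) ^ 2 := by
  unfold FF
  rw [show x + 2 + a + b = x + a + b + 2 by ring, show x + 1 + a + b = x + a + b + 1 by ring]
  have e : (x : ℝ) + 1 + a + b = ((x + a + b : ℕ) : ℝ) + 1 := by push_cast; ring
  rw [e]
  generalize x + a + b = s
  rw [hR_succ (x + 1), hR_succ x, fR_succ x,
    show 2 * (s + 2) + 2 = 2 * s + 6 by ring, show 2 * (s + 1) + 2 = 2 * s + 4 by ring,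
    hR_succ (s + 1), hR_succ s, hR_succ (2 * s + 5), hR_succ (2 * s + 4), hR_succ (2 * s + 3),
    hR_succ (2 * s + 2), kR_succ (s + 2), kR_succ (s + 1),
    show 2 * (s + 2) + 1 = 2 * s + 5 by ring, show 2 * (s + 1) + 1 = 2 * s + 3 by ring,
    fR_succ (2 * s + 4), fR_succ (2 * s + 3), fR_succ (2 * s + 2),
    fR_succ (s + 1), fR_succ s]
  have i1 := hR_ne
  have i2 := kR_ne
  have i3 := fR_ne
  push_cast
  have j1 : (s : ℝ) + 1 ≠ 0 := by positivity
  have j2 : (s : ℝ) + 1 + 1 ≠ 0 := by positivity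
  have j3 : 2 * (s : ℝ) + 2 + 1 ≠ 0 := by positivity
  have j4 : 2 * (s : ℝ) + 3 + 1 ≠ 0 := by positivity
  have j5 : 2 * (s : ℝ) + 4 + 1 ≠ 0 := by positivity
  field_simp
  ring

lemma WW_rec (a b w : ℕ) :
    WW a b (w + 2) * WW a b w =
      2 * ((w : ℝ) + 2 + 2 * a + 2 * b) * (2 * (w + 1 + a + b) + 1) * WW a b (w + 1) ^ 2 := by
  unfold WW
  rw [show w + 2 + a + b = w + a + b + 2 by ring, show w + 1 + a + b = w + a + b + 1 by ring,
    show w + 2 + 2 * a + 2 * b + 1 = w + 2 * a + 2 * b + 1 + 2 by ring,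
    show w + 1 + 2 * a + 2 * b + 1 = w + 2 * a + 2 * b + 1 + 1 by ring]
  have e : (w : ℝ) + 1 + a + b = ((w + a + b : ℕ) : ℝ) + 1 := by push_cast; ring
  have e' : (w : ℝ) + 2 + 2 * a + 2 * b = ((w + 2 * a + 2 * b + 1 : ℕ) : ℝ) + 1 := by
    push_cast; ring
  rw [e, e']
  generalize w + a + b = s
  generalize w + 2 * a + 2 * b + 1 = t
  rw [hR_succ (t + 1), hR_succ t, fR_succ t,
    hR_succ (s + 2), hR_succ (s + 1), kR_succ (s + 1), kR_succ s,
    show 2 * (s + 1) + 1 = 2 * s + 3 by ring,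
    fR_succ (2 * s + 2), fR_succ (2 * s + 1), fR_succ (s + 1), fR_succ s]
  have i1 := hR_ne
  have i2 := kR_ne
  have i3 := fR_ne
  push_cast
  have j1 : (s : ℝ) + 1 ≠ 0 := by positivity
  have j2 : (s : ℝ) + 1 + 1 ≠ 0 := by positivity
  field_simp
  ring

set_option maxHeartbeats 4000000 in
lemma GG_rec (a b n : ℕ) :
    GG a b (n + 2) * GG a b n * (2 * (2 * a + 2 * (n + 1 + b) + 1)) = GG a b (n + 1) ^ 2 := by
  unfold GG
  have e : (n : ℝ) + 1 + b = ((n + b : ℕ) : ℝ) + 1 := by push_cast; ring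
  rw [e, show n + 2 + b = n + b + 2 by ring, show n + 1 + b = n + b + 1 by ring,
    show n + a + b + 1 = n + b + a + 1 by ring,
    show n + 2 + a + b + 1 = n + b + a + 1 + 2 by ring,
    show n + 1 + a + b + 1 = n + b + a + 1 + 1 by ring,
    show n + 2 * a + b + 1 = n + b + 2 * a + 1 by ring,
    show n + 2 + 2 * a + b + 1 = n + b + 2 * a + 1 + 2 by ring,
    show n + 1 + 2 * a + b + 1 = n + b + 2 * a + 1 + 1 by ring]
  generalize n + b = s
  have q1 := h2 s
  have q2 := h2 (s + a + 1)
  have q3 := h2 (s + 2 * a + 1)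
  rw [Pf_succ (s + 1), Pf_succ s, kR_succ (s + 1), kR_succ s,
    hR_succ (s + 1), hR_succ s, hR_succ (s + a + 1 + 1), hR_succ (s + a + 1),
    hR_succ (s + 2 * a + 1 + 1), hR_succ (s + 2 * a + 1),
    show 2 * (s + 1) + 1 = 2 * s + 1 + 1 + 1 by ring,
    show 2 * a + 2 * (s + 1) + 1 = 2 * a + 2 * s + 1 + 1 + 1 by ring,
    show 2 * a + (s + 1) + 1 = s + 2 * a + 1 + 1 by ring,
    show 2 * a + s + 1 = s + 2 * a + 1 by ring,
    fR_succ (2 * s + 1 + 1), fR_succ (2 * s + 1), fR_succ (2 * a + 2 * s + 1 + 1),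
    fR_succ (2 * a + 2 * s + 1), fR_succ (s + 2 * a + 1), fR_succ (s + a + 1),
    fR_succ (s + 1), fR_succ s]
  have i1 := hR_ne
  have i2 := kR_ne
  have i3 := fR_ne
  have i4 := Pf_ne
  push_cast
  have j1 : (s : ℝ) + 1 ≠ 0 := by positivity
  have j2 : (s : ℝ) + 1 + 1 ≠ 0 := by positivity
  have j3 : 2 * (s : ℝ) + 1 + 1 ≠ 0 := by positivity
  have j4 : 2 * (s : ℝ) + 1 + 1 + 1 ≠ 0 := by positivity
  have j5 : 2 * (a : ℝ) + 2 * s + 1 + 1 ≠ 0 := by positivity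
  have j6 : 2 * (a : ℝ) + 2 * s + 1 + 1 + 1 ≠ 0 := by positivity
  have j7 : (s : ℝ) + 2 * a + 1 + 1 ≠ 0 := by positivity
  have j8 : (a : ℝ) + s + 1 ≠ 0 := by positivity
  have j9 : (a : ℝ) + (s + 1) + 1 ≠ 0 := by positivity
  field_simp
  ring

/-- Kuo condensation recurrence for `φ`. -/
theorem claim_phi_kuo (x y z a b : ℕ) (hx : 1 ≤ x) (hy : 1 ≤ y) (hz : 1 ≤ z)
    (ha : 1 ≤ a) (hb : 1 ≤ b) :
    phi x y z a b * phi x (y - 1) (z - 1) a b =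
      phi x (y - 1) z a b * phi x y (z - 1) a b +
        phi (x + 1) (y - 1) (z - 1) a b * phi (x - 1) y z a b := by
  obtain ⟨x, rfl⟩ := Nat.exists_eq_add_of_le' hx
  obtain ⟨y, rfl⟩ := Nat.exists_eq_add_of_le' hy
  obtain ⟨z, rfl⟩ := Nat.exists_eq_add_of_le' hz
  simp only [Nat.add_sub_cancel, phi_eq]
  have hF := FF_rec a b x
  have hG := GG_rec a b (y + z)
  have hW := WW_rec a b (x + y + z + 1)
  have hL := LL_rec a b (2 * x + y + z + 2)
  rw [show x + 1 + (y + 1) = x + y + 2 by ring, show x + 1 + (z + 1) = x + z + 2 by ring,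
    show y + 1 + (z + 1) = y + z + 2 by ring, show x + y + 2 + (z + 1) = x + y + z + 1 + 2 by ring,
    show 2 * (x + 1) + (y + 1) + (z + 1) = 2 * x + y + z + 2 + 2 by ring,
    show x + 1 + y = x + y + 1 by ring, show x + 1 + z = x + z + 1 by ring,
    show x + y + 1 + z = x + y + z + 1 by ring,
    show 2 * (x + 1) + y + z = 2 * x + y + z + 2 by ring,
    show y + (z + 1) = y + z + 1 by ring, show y + 1 + z = y + z + 1 by ring,
    show x + y + 1 + (z + 1) = x + y + z + 1 + 1 by ring,
    show 2 * (x + 1) + y + (z + 1) = 2 * x + y + z + 2 + 1 by ring,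
    show x + y + 2 + z = x + y + z + 1 + 1 by ring,
    show 2 * (x + 1) + (y + 1) + z = 2 * x + y + z + 2 + 1 by ring,
    show x + 1 + 1 + y = x + y + 2 by ring, show x + 1 + 1 + z = x + z + 2 by ring,
    show x + y + 2 + z = x + y + z + 1 + 1 by ring,
    show 2 * (x + 1 + 1) + y + z = 2 * x + y + z + 2 + 2 by ring,
    show x + (y + 1) = x + y + 1 by ring, show x + (z + 1) = x + z + 1 by ring,
    show x + y + 1 + (z + 1) = x + y + z + 1 + 1 by ring,
    show 2 * x + (y + 1) + (z + 1) = 2 * x + y + z + 2 by ring,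
    show x + 1 + 1 = x + 2 by ring]
  push_cast at hF hG hW hL
  generalize hc : KK a b (y + 1) * KK a b y * ZZ a b (z + 1) * ZZ a b z * MM a b (x + y + 2) *
    MM a b (x + y + 1) * NN a b (x + z + 2) * NN a b (x + z + 1) = c
  have key : FF a b (x + 1) ^ 2 * (GG a b (y + z + 2) * GG a b (y + z)) *
      (WW a b (x + y + z + 1 + 2) * WW a b (x + y + z + 1)) *
      (LL a b (2 * x + y + z + 2 + 2) * LL a b (2 * x + y + z + 2)) =
      FF a b (x + 1) ^ 2 * GG a b (y + z + 1) ^ 2 * WW a b (x + y + z + 1 + 1) ^ 2 *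
        LL a b (2 * x + y + z + 2 + 1) ^ 2 +
      (FF a b (x + 2) * FF a b x) * (GG a b (y + z + 2) * GG a b (y + z)) *
        WW a b (x + y + z + 1 + 1) ^ 2 *
        (LL a b (2 * x + y + z + 2 + 2) * LL a b (2 * x + y + z + 2)) := by
    rw [hF, hW, ← hG, ← hL]
    ring
  subst hc
  linear_combination (KK a b (y + 1) * KK a b y * ZZ a b (z + 1) * ZZ a b z *
    MM a b (x + y + 2) * MM a b (x + y + 1) * NN a b (x + z + 2) * NN a b (x + z + 1)) * key
end

section
/- For all integers x, y, z ≥ 1 and a, b ≥ 1, the explicit product ψ_{x,y,z}(a,b) satisfies the Kuo condensation recurrence ψ_{x,y,z}(a,b) · ψ_{x,y-1,z-1}(a,b) = ψ_{x,y-1,z}(a,b) · ψ_{x,y,z-1}(a,b) + ψ_{x+1,y-1,z-1}(a,b) · ψ_{x-1,y,z}(a,b). -/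
open Finset Nat

namespace PsiKuo

/-- Real-valued hyperfactorial. -/
noncomputable def H (n : ℕ) : ℝ := (hyperfac n : ℝ)

/-- Odd skipping hyperfactorial. -/
noncomputable def J (n : ℕ) : ℝ := (hyperfac2 (2 * n + 1) : ℝ)

/-- Odd double factorials `1·3⋯(2n-1)`. -/
noncomputable def g (n : ℕ) : ℝ := ∏ j ∈ Finset.range n, (2 * (j : ℝ) + 1)

/-- Products of odd double factorials. -/
noncomputable def G (n : ℕ) : ℝ := ∏ j ∈ Finset.range n, g j

lemma H_pos (n : ℕ) : 0 < H n := by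
  unfold H hyperfac
  exact_mod_cast Finset.prod_pos fun i _ => Nat.factorial_pos i

lemma H_succ (n : ℕ) : H (n + 1) = H n * (n ! : ℝ) := by
  simp [H, hyperfac, Finset.prod_range_succ]

lemma J_eq (n : ℕ) : J n = ∏ i ∈ Finset.range n, ((2 * i + 1)! : ℝ) := by
  unfold J hyperfac2
  have h1 : (2 * n + 1) / 2 = n := by omega
  have h2 : (2 * n + 1) % 2 ≠ 0 := by omega
  simp [h1]

lemma J_pos (n : ℕ) : 0 < J n := by
  rw [J_eq]
  exact Finset.prod_pos fun i _ => by positivity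

lemma J_succ (n : ℕ) : J (n + 1) = J n * ((2 * n + 1)! : ℝ) := by
  simp [J_eq, Finset.prod_range_succ]

lemma g_pos (n : ℕ) : 0 < g n := Finset.prod_pos fun i _ => by positivity

lemma g_succ (n : ℕ) : g (n + 1) = g n * (2 * (n : ℝ) + 1) := by
  simp [g, Finset.prod_range_succ]

lemma G_pos (n : ℕ) : 0 < G n := Finset.prod_pos fun i _ => g_pos i

lemma G_succ (n : ℕ) : G (n + 1) = G n * g n := by
  simp [G, Finset.prod_range_succ]

lemma prod_fact_shift (m y : ℕ) :
    ∏ j ∈ Finset.range y, ((m + j)! : ℝ) = H (m + y) / H m := by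
  induction y with
  | zero => simp [(H_pos m).ne']
  | succ k ih =>
    rw [Finset.prod_range_succ, ih, ← add_assoc, H_succ]
    ring

lemma prod_g_shift (m y : ℕ) :
    ∏ j ∈ Finset.range y, g (m + j) = G (m + y) / G m := by
  induction y with
  | zero => simp [(G_pos m).ne']
  | succ k ih =>
    rw [Finset.prod_range_succ, ih, ← add_assoc, G_succ]
    ring

lemma prod_up (m k : ℕ) :
    (m ! : ℝ) * ∏ i ∈ Finset.range k, ((m : ℝ) + 1 + i) = ((m + k)! : ℝ) := by
  induction k with
  | zero => simp
  | succ k ih =>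
    rw [Finset.prod_range_succ, ← mul_assoc, ih, ← add_assoc, Nat.factorial_succ]
    push_cast; ring

lemma g_up (m k : ℕ) :
    g m * ∏ i ∈ Finset.range k, (2 * (m : ℝ) + 1 + 2 * i) = g (m + k) := by
  induction k with
  | zero => simp
  | succ k ih =>
    rw [Finset.prod_range_succ, ← mul_assoc, ih, ← add_assoc, g_succ]
    push_cast; ring

/-- `(p+1)_{r-p} = r!/p!`. -/
lemma poch_eq (p r : ℕ) : poch ((p : ℝ) + 1) ((r : ℤ) - p) = (r ! : ℝ) / (p ! : ℝ) := by
  unfold poch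
  have hp : (p ! : ℝ) ≠ 0 := by positivity
  have hr : (r ! : ℝ) ≠ 0 := by positivity
  split_ifs with h
  · obtain ⟨k, rfl⟩ : ∃ k, r = p + k := ⟨r - p, by omega⟩
    have : (((p + k : ℕ) : ℤ) - p).toNat = k := by omega
    rw [this, eq_div_iff hp, mul_comm, prod_up]
  · obtain ⟨k, rfl⟩ : ∃ k, p = r + k := ⟨p - r, by omega⟩
    have : (-((r : ℤ) - (r + k : ℕ))).toNat = k := by omega
    rw [this, ← Finset.prod_range_reflect]
    rw [← prod_up r k] 
    have e : ∏ j ∈ Finset.range k, (((r + k : ℕ) : ℝ) + 1 - (((k - 1 - j : ℕ) : ℝ) + 1))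
        = ∏ i ∈ Finset.range k, ((r : ℝ) + 1 + i) := by
      refine Finset.prod_congr rfl fun j hj => ?_
      have hj := Finset.mem_range.1 hj
      have : k = (k - 1 - j) + 1 + j := by omega
      have : (k : ℝ) = ((k - 1 - j : ℕ) : ℝ) + 1 + j := by exact_mod_cast this
      push_cast
      linarith
    rw [e]
    have : ∏ i ∈ Finset.range k, ((r : ℝ) + 1 + i) ≠ 0 :=
      (Finset.prod_pos fun i _ => by positivity).ne'
    field_simp

lemma spoch_eq (p r : ℕ) : spoch (2 * (p : ℝ) + 1) ((r : ℤ) - p) = g r / g p := by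
  unfold spoch
  have hp : g p ≠ 0 := (g_pos p).ne'
  have hr : g r ≠ 0 := (g_pos r).ne'
  split_ifs with h
  · obtain ⟨k, rfl⟩ : ∃ k, r = p + k := ⟨r - p, by omega⟩
    have : (((p + k : ℕ) : ℤ) - p).toNat = k := by omega
    rw [this, eq_div_iff hp, mul_comm, g_up]
  · obtain ⟨k, rfl⟩ : ∃ k, p = r + k := ⟨p - r, by omega⟩
    have : (-((r : ℤ) - (r + k : ℕ))).toNat = k := by omega
    rw [this, ← Finset.prod_range_reflect]
    rw [← g_up r k]
    have e : ∏ j ∈ Finset.range k, (2 * ((r + k : ℕ) : ℝ) + 1 - 2 * (((k - 1 - j : ℕ) : ℝ) + 1))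
        = ∏ i ∈ Finset.range k, (2 * (r : ℝ) + 1 + 2 * i) := by
      refine Finset.prod_congr rfl fun j hj => ?_
      have hj := Finset.mem_range.1 hj
      have : k = (k - 1 - j) + 1 + j := by omega
      have : (k : ℝ) = ((k - 1 - j : ℕ) : ℝ) + 1 + j := by exact_mod_cast this
      push_cast
      linarith
    rw [e]
    have : ∏ i ∈ Finset.range k, (2 * (r : ℝ) + 1 + 2 * i) ≠ 0 :=
      (Finset.prod_pos fun i _ => by positivity).ne'
    field_simp

lemma trapT_eq (q : ℝ) (N : ℤ) (m k c : ℕ) (hq : q = (m : ℝ) + 1)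
    (hN : N = (c : ℤ) + k - 1) :
    trapT q N c = H (m + k + c) * H m / (H (m + k) * H (m + c)) := by
  subst hq hN
  unfold trapT
  have e : ∀ i ∈ Finset.range (c : ℤ).toNat,
      poch ((m : ℝ) + 1 + i) ((c : ℤ) + k - 1 - 2 * i)
        = ((m + k + (c - 1 - i))! : ℝ) / ((m + i)! : ℝ) := by
    intro i hi
    have hi := Finset.mem_range.1 hi
    rw [← poch_eq]
    congr 1
    · push_cast; ring
    · omega
  rw [Finset.prod_congr rfl e, Finset.prod_div_distrib, Int.toNat_natCast,
    Finset.prod_range_reflect (fun j => ((m + k + j)! : ℝ)), prod_fact_shift, prod_fact_shift]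
  have := (H_pos m).ne'
  have := (H_pos (m + k)).ne'
  have := (H_pos (m + c)).ne'
  field_simp

lemma trapV_eq (q : ℝ) (N : ℤ) (m k c : ℕ) (hq : q = 2 * (m : ℝ) + 1)
    (hN : N = (c : ℤ) + k - 1) :
    trapV q N c = G (m + k + c) * G m / (G (m + k) * G (m + c)) := by
  subst hq hN
  unfold trapV
  have e : ∀ i ∈ Finset.range (c : ℤ).toNat,
      spoch (2 * (m : ℝ) + 1 + 2 * i) ((c : ℤ) + k - 1 - 2 * i)
        = g (m + k + (c - 1 - i)) / g (m + i) := by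
    intro i hi
    have hi := Finset.mem_range.1 hi
    rw [← spoch_eq]
    congr 1
    · push_cast; ring
    · omega
  rw [Finset.prod_congr rfl e, Finset.prod_div_distrib, Int.toNat_natCast,
    Finset.prod_range_reflect (fun j => g (m + k + j)), prod_g_shift, prod_g_shift]
  have := (G_pos m).ne'
  have := (G_pos (m + k)).ne'
  have := (G_pos (m + c)).ne'
  field_simp

/-- Proctor's diagonal product. -/
noncomputable def F (a N : ℕ) : ℝ := Pf N N a

/-- One row of the diagonal product. -/
noncomputable def rowU (a i : ℕ) : ℝ :=
  (((a + i : ℕ) : ℝ) / (i : ℝ)) *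
    (((2 * a + 2 * i - 1)! : ℝ) / ((2 * a + i)! : ℝ) * ((i ! : ℝ) / ((2 * i - 1)! : ℝ)))

lemma row_aux (c i k : ℕ) :
    ∏ j ∈ Finset.Icc 2 (k + 1), ((c + i + j - 1 : ℕ) : ℝ) = ((c + i + k)! : ℝ) / ((c + i)! : ℝ) := by
  induction k with
  | zero => simp; field_simp
  | succ k ih =>
    rw [Finset.prod_Icc_succ_top (by omega), ih,
      show c + i + (k + 1 + 1) - 1 = c + i + k + 1 by omega,
      show c + i + (k + 1) = c + i + k + 1 by omega, Nat.factorial_succ (c + i + k)]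
    push_cast; ring

lemma F_succ (a N : ℕ) : F a (N + 1) = F a N * rowU a (N + 1) := by
  unfold F Pf
  simp only [Nat.sub_self, Nat.zero_add]
  rw [Finset.prod_Icc_succ_top (by omega)]
  congr 1
  rw [Finset.prod_div_distrib, Finset.prod_div_distrib]
  have h1 := row_aux (2 * a) (N + 1) N
  have h2 := row_aux 0 (N + 1) N
  simp only [zero_add] at h2
  rw [h1, h2]
  unfold rowU
  have e1 : 2 * a + 2 * (N + 1) - 1 = 2 * a + (N + 1) + N := by omega
  have e2 : 2 * (N + 1) - 1 = N + 1 + N := by omega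
  rw [e1, e2]
  simp only [Finset.Icc_self, Finset.prod_singleton, Nat.add_sub_cancel]
  field_simp

lemma rowU_pos (a N : ℕ) : 0 < rowU a (N + 1) := by
  unfold rowU; positivity

lemma F_pos (a N : ℕ) : 0 < F a N := by
  induction N with
  | zero => simp [F, Pf]
  | succ k ih => rw [F_succ]; exact mul_pos ih (rowU_pos a k)

lemma rowU_succ (a N : ℕ) :
    rowU a (N + 2) * ((2 * a + N + 2 : ℝ) * (2 * N + 3)) =
      rowU a (N + 1) * ((a + N + 2 : ℝ) * (2 * a + 2 * N + 3)) := by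
  unfold rowU
  have e1 : 2 * a + 2 * (N + 2) - 1 = 2 * a + 2 * N + 1 + 1 + 1 := by omega
  have e2 : 2 * (N + 2) - 1 = 2 * N + 1 + 1 + 1 := by omega
  have e3 : 2 * a + 2 * (N + 1) - 1 = 2 * a + 2 * N + 1 := by omega
  have e4 : 2 * (N + 1) - 1 = 2 * N + 1 := by omega
  have e5 : 2 * a + (N + 2) = 2 * a + (N + 1) + 1 := by omega
  rw [e1, e2, e3, e4, e5]
  rw [Nat.factorial_succ (2 * a + 2 * N + 1 + 1), Nat.factorial_succ (2 * a + 2 * N + 1),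
    Nat.factorial_succ (2 * N + 1 + 1), Nat.factorial_succ (2 * N + 1),
    Nat.factorial_succ (2 * a + (N + 1)), Nat.factorial_succ (N + 1)]
  push_cast
  field_simp
  ring

/-- Factor depending on `y`. -/
noncomputable def fy (a b y : ℕ) : ℝ :=
  Pf' y (y + 2 * a + 1) b * trapT (2 * (a : ℝ) + b + 2) ((y : ℤ) + b - 1) b *
    H (b + y) / G (a + b + 1 + y)

/-- Factor depending on `z`. -/
noncomputable def fz (a b z : ℕ) : ℝ :=
  Pf (z + b) (z + b) a * H (b + z + 2 * a + 1) * H z / (H (z + b) * G (a + b + 1 + z))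

/-- Factor depending on `x + y`. -/
noncomputable def fxy (a b k : ℕ) : ℝ :=
  G (a + b + 1 + k) * H (2 * a + b + 1 + k) / (H (b + k) * H (2 * a + 2 * b + 1 + k))

/-- Factor depending on `x + z`. -/
noncomputable def fxz (a b k : ℕ) : ℝ :=
  G (a + b + 1 + k) * H (b + k) / (H (2 * a + b + 1 + k) * H k)

/-- Factor depending on `x`. -/
noncomputable def fx (a b x : ℕ) : ℝ :=
  H (2 * (a + b + x) + 2) * H x / (((a + b + x)! : ℝ) * J (a + b + x + 1) * G (a + b + x + 1))

/-- Factor depending on `y + z`. -/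
noncomputable def fn (a b n : ℕ) : ℝ :=
  H (b + n) * G (a + b + 1 + n) / (J (b + n) * F a (b + n) * H (2 * a + b + 1 + n))

/-- Factor depending on `x + y + z`. -/
noncomputable def ft (a b t : ℕ) : ℝ :=
  ((a + b + t)! : ℝ) * J (a + b + t) * H (2 * a + 2 * b + 1 + t) / G (a + b + t + 1)

/-- Constant factor. -/
noncomputable def K (a b : ℕ) : ℝ :=
  ((a + b)! : ℝ) / (a ! : ℝ) * (J (a + b) * H (2 * a + 2) / J (a + 1)) *
    (H b / H (2 * a + b + 1)) * (G (a + b + 1) / H b)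

lemma Q4_eq (a b x n : ℕ) : Q4 a b x n =
    ((a + b)! : ℝ) / (a ! : ℝ) * (J (a + b) * H (2 * a + 2) / J (a + 1)) *
    (H b / H (2 * a + b + 1)) *
    (((a + b + x + n)! : ℝ) / ((a + b + x)! : ℝ)) / J (b + n) *
    (J (a + b + x + n) * H (2 * (a + b + x) + 2) / J (a + b + x + 1)) *
    (H x / H (2 * a + 2 * b + 1 + x)) * (H n / H (2 * a + 2 * b + 1 + (2 * x + n))) *
    (H (b + (x + n)) / H (2 * a + b + 1 + (x + n))) *
    (H (2 * a + b + 1 + x) / H (b + x)) *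
    (H (2 * a + 2 * b + 1 + (x + n)) / H (x + n)) := by
  have s1 : pSum (seqOf [a, b, x, n]) 1 = a := by simp [pSum, seqOf]
  have s2 : pSum (seqOf [a, b, x, n]) 2 = a + b := by
    simp [pSum, seqOf, Finset.sum_Icc_succ_top]
  have s3 : pSum (seqOf [a, b, x, n]) 3 = a + b + x := by
    simp [pSum, seqOf, Finset.sum_Icc_succ_top]
  have s4 : pSum (seqOf [a, b, x, n]) 4 = a + b + x + n := by
    simp [pSum, seqOf, Finset.sum_Icc_succ_top]
  have sE : evenSum 2 (seqOf [a, b, x, n]) = b + n := by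
    simp [evenSum, seqOf, Finset.sum_Icc_succ_top]
  have i2 : Finset.Icc 1 2 = ({1, 2} : Finset ℕ) := by decide
  have o : (Finset.Icc 1 (2 * 2) ×ˢ Finset.Icc 1 (2 * 2)).filter
        (fun p : ℕ × ℕ => p.1 < p.2 ∧ (p.2 - p.1) % 2 = 1) =
        {(1, 2), (2, 3), (3, 4), (1, 4)} := by decide
  have e : (Finset.Icc 1 (2 * 2) ×ˢ Finset.Icc 1 (2 * 2)).filter
        (fun p : ℕ × ℕ => p.1 < p.2 ∧ (p.2 - p.1) % 2 = 0) =
        {(1, 3), (2, 4)} := by decide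
  unfold Q4 Qfun
  rw [o, e, i2, sE]
  rw [Finset.prod_insert (by decide), Finset.prod_insert (by decide),
    Finset.prod_insert (by decide), Finset.prod_insert (by decide),
    Finset.prod_insert (by decide), Finset.prod_insert (by decide)]
  simp only [Finset.prod_singleton, Nat.reduceMul, Nat.reduceSub, s1, s2, s3, s4]
  have hH : ∀ n, (hyperfac n : ℝ) = H n := fun _ => rfl
  have hJ : ∀ n, (hyperfac2 (2 * n + 1) : ℝ) = J n := fun _ => rfl
  have hJ' : ∀ n, (hyperfac2 (2 * n + 3) : ℝ) = J (n + 1) := fun _ => rfl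
  simp only [hH, hJ, hJ']
  rw [show a + b - a = b by omega, show a + b + x - (a + b) = x by omega,
    show a + b + x + n - (a + b + x) = n by omega,
    show a + b + x + n - a = b + (x + n) by omega,
    show a + b + x - a = b + x by omega,
    show a + b + x + n - (a + b) = x + n by omega,
    show a + b + a + 1 = 2 * a + b + 1 by omega,
    show a + b + x + (a + b) + 1 = 2 * a + 2 * b + 1 + x by omega,
    show a + b + x + n + (a + b + x) + 1 = 2 * a + 2 * b + 1 + (2 * x + n) by omega,
    show a + b + x + n + a + 1 = 2 * a + b + 1 + (x + n) by omega,
    show a + b + x + a + 1 = 2 * a + b + 1 + x by omega,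
    show a + b + x + n + (a + b) + 1 = 2 * a + 2 * b + 1 + (x + n) by omega]
  ring

lemma psi_eq (x y z a b : ℕ) : psi x y z a b =
    K a b * fy a b y * fz a b z * fxy a b (x + y) * fxz a b (x + z) *
      (fx a b x * fn a b (y + z) * ft a b (x + (y + z)) / H (2 * a + 2 * b + 1 + (2 * x + (y + z))))
    := by
  have t1 := trapV_eq (2 * (a : ℝ) + 2 * b + 3) ((y : ℤ) + z - 1) (a + b + 1) z y
    (by push_cast; ring) (by ring)
  have t2 := trapV_eq (2 * (x : ℝ) + 2 * a + 2 * b + 3) ((y : ℤ) + z - 1) (a + b + 1 + x) z y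
    (by push_cast; ring) (by ring)
  have t3 := trapT_eq ((x : ℝ) + b + 1) ((y : ℤ) + z + 2 * a) (b + x) (z + 2 * a + 1) y
    (by push_cast; ring) (by push_cast; ring)
  have t4 := trapT_eq ((z : ℝ) + 1) ((y : ℤ) + b - 1) z y b
    (by push_cast; ring) (by push_cast; ring)
  have t5 := trapT_eq ((b : ℝ) + 1) ((y : ℤ) + z + 2 * a) b (z + 2 * a + 1) y
    (by push_cast; ring) (by push_cast; ring)
  have t6 := trapT_eq ((x : ℝ) + 2 * a + b + 2) ((y : ℤ) + b - 1) (2 * a + b + 1 + x) y b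
    (by push_cast; ring) (by push_cast; ring)
  have t7 := trapT_eq ((x : ℝ) + z + 1) ((y : ℤ) + b - 1) (x + z) y b
    (by push_cast; ring) (by push_cast; ring)
  unfold psi
  rw [t1, t2, t3, t4, t5, t6, t7, Q4_eq]
  unfold fy fz fxy fxz fx fn ft K
  have hF : Pf (y + z + b) (y + z + b) a = F a (b + (y + z)) := by
    unfold F; rw [add_comm b]
  rw [hF]
  generalize trapT (2 * (a : ℝ) + b + 2) ((y : ℤ) + b - 1) b = W1
  generalize Pf' y (y + 2 * a + 1) b = W2
  generalize Pf (z + b) (z + b) a = W3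
  -- normalise the arguments
  rw [show a + b + 1 + z + y = a + b + 1 + (y + z) by omega,
    show a + b + 1 + x + z + y = a + b + (x + (y + z)) + 1 by omega,
    show a + b + 1 + x + z = a + b + 1 + (x + z) by omega,
    show a + b + 1 + x + y = a + b + 1 + (x + y) by omega,
    show a + b + 1 + x = a + b + x + 1 by omega,
    show b + x + (z + 2 * a + 1) + y = 2 * a + b + 1 + (x + (y + z)) by omega,
    show b + x + (z + 2 * a + 1) = 2 * a + b + 1 + (x + z) by omega,
    show b + x + y = b + (x + y) by omega,
    show z + y + b = b + (y + z) by omega,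
    show z + y = y + z by omega,
    show b + (z + 2 * a + 1) + y = 2 * a + b + 1 + (y + z) by omega,
    show b + (z + 2 * a + 1) = b + z + 2 * a + 1 by omega,
    show 2 * a + b + 1 + x + y + b = 2 * a + 2 * b + 1 + (x + y) by omega,
    show 2 * a + b + 1 + x + y = 2 * a + b + 1 + (x + y) by omega,
    show 2 * a + b + 1 + x + b = 2 * a + 2 * b + 1 + x by omega,
    show x + z + y + b = b + (x + (y + z)) by omega,
    show x + z + y = x + (y + z) by omega,
    show x + z + b = b + (x + z) by omega,
    show a + b + x + (y + z) = a + b + (x + (y + z)) by omega]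
  have nH := fun n => (H_pos n).ne'
  have nG := fun n => (G_pos n).ne'
  have nJ := fun n => (J_pos n).ne'
  have nF := (F_pos a (b + (y + z))).ne'
  have n1 : ((a + b + x)! : ℝ) ≠ 0 := by positivity
  have n2 : (a ! : ℝ) ≠ 0 := by positivity
  field_simp [nH, nG, nJ, nF, n1, n2]

lemma fx_rel (a b x : ℕ) : fx a b (x + 2) * fx a b x =
    (fx a b (x + 1)) ^ 2 * (2 * (x + 1) * (a + b + x + 1)) := by
  unfold fx
  generalize hc : a + b = c
  have hc' : (a : ℝ) + b = c := by exact_mod_cast hc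
  rw [show c + (x + 2) = c + x + 2 by omega, show c + (x + 1) = c + x + 1 by omega,
    show (a : ℝ) + b + x + 1 = ((c + x : ℕ) : ℝ) + 1 by push_cast; linarith]
  generalize c + x = s
  rw [show 2 * (s + 2) + 2 = 2 * s + 2 + 1 + 1 + 1 + 1 by omega,
    show 2 * (s + 1) + 2 = 2 * s + 2 + 1 + 1 by omega]
  rw [H_succ (2 * s + 2 + 1 + 1 + 1), H_succ (2 * s + 2 + 1 + 1), H_succ (2 * s + 2 + 1),
    H_succ (2 * s + 2), H_succ (x + 1), H_succ x, J_succ (s + 2), J_succ (s + 1),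
    G_succ (s + 2), G_succ (s + 1), g_succ (s + 1),
    show 2 * (s + 2) + 1 = 2 * s + 2 + 1 + 1 + 1 by omega,
    show 2 * (s + 1) + 1 = 2 * s + 2 + 1 by omega,
    Nat.factorial_succ (2 * s + 2 + 1 + 1), Nat.factorial_succ (2 * s + 2 + 1),
    Nat.factorial_succ (2 * s + 2), Nat.factorial_succ (s + 1), Nat.factorial_succ s,
    Nat.factorial_succ x]
  have nH := fun n => (H_pos n).ne'
  have nG := fun n => (G_pos n).ne'
  have nJ := fun n => (J_pos n).ne'
  have ng := fun n => (g_pos n).ne'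
  push_cast
  field_simp [nH, nG, nJ, ng]
  ring

lemma ft_rel (a b t : ℕ) : ft a b (t + 2) * ft a b t =
    (ft a b (t + 1)) ^ 2 * (2 * (a + b + t + 2) * (2 * a + 2 * b + t + 2)) := by
  unfold ft
  generalize hc : a + b = c
  have hc' : (a : ℝ) + b = c := by exact_mod_cast hc
  rw [show c + (t + 2) = c + t + 1 + 1 by omega, show c + (t + 1) = c + t + 1 by omega,
    show 2 * a + 2 * b + 1 + (t + 2) = c + (c + t) + 1 + 1 + 1 by omega,
    show 2 * a + 2 * b + 1 + (t + 1) = c + (c + t) + 1 + 1 by omega,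
    show 2 * a + 2 * b + 1 + t = c + (c + t) + 1 by omega,
    show (a : ℝ) + b + t + 2 = ((c + t : ℕ) : ℝ) + 2 by push_cast; linarith,
    show 2 * (a : ℝ) + 2 * b + t + 2 = c + ((c + t : ℕ) : ℝ) + 2 by push_cast; linarith]
  generalize c + t = s
  rw [H_succ (c + s + 1 + 1), H_succ (c + s + 1), Nat.factorial_succ (c + s + 1),
    J_succ (s + 1), J_succ s, G_succ (s + 1 + 1), G_succ (s + 1), g_succ (s + 1),
    show 2 * (s + 1) + 1 = 2 * s + 1 + 1 + 1 by omega,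
    Nat.factorial_succ (2 * s + 1 + 1), Nat.factorial_succ (2 * s + 1),
    Nat.factorial_succ (s + 1), Nat.factorial_succ s]
  have nG := fun n => (G_pos n).ne'
  have ng := fun n => (g_pos n).ne'
  push_cast
  field_simp [nG, ng]
  ring

lemma fn_rel (a b n : ℕ) (hb : 1 ≤ b) : (fn a b (n + 1)) ^ 2 =
    fn a b (n + 2) * fn a b n * (2 * (a + b + n + 2)) := by
  obtain ⟨N, hN⟩ : ∃ N, b + n = N + 1 := ⟨b + n - 1, by omega⟩
  unfold fn
  have hN' : (b : ℝ) + n = N + 1 := by exact_mod_cast hN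
  rw [show b + (n + 2) = N + 3 by omega, show b + (n + 1) = N + 2 by omega, hN,
    show a + b + 1 + (n + 2) = a + N + 2 + 1 + 1 by omega,
    show a + b + 1 + (n + 1) = a + N + 2 + 1 by omega,
    show a + b + 1 + n = a + N + 2 by omega,
    show 2 * a + b + 1 + (n + 2) = 2 * a + N + 2 + 1 + 1 by omega,
    show 2 * a + b + 1 + (n + 1) = 2 * a + N + 2 + 1 by omega,
    show 2 * a + b + 1 + n = 2 * a + N + 2 by omega,
    show (a : ℝ) + b + n + 2 = a + N + 3 by linarith]
  rw [H_succ (2 * a + N + 2 + 1), H_succ (2 * a + N + 2), Nat.factorial_succ (2 * a + N + 2),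
    G_succ (a + N + 2 + 1), G_succ (a + N + 2), g_succ (a + N + 2),
    H_succ (N + 2), H_succ (N + 1), Nat.factorial_succ (N + 1),
    J_succ (N + 2), J_succ (N + 1), show 2 * (N + 2) + 1 = 2 * (N + 1) + 1 + 1 + 1 by omega,
    Nat.factorial_succ (2 * (N + 1) + 1 + 1), Nat.factorial_succ (2 * (N + 1) + 1),
    F_succ a (N + 2), F_succ a (N + 1)]
  have hU := rowU_succ a (N + 1)
  have hU' : rowU a (N + 2 + 1) = rowU a (N + 1 + 1) * ((a + N + 3 : ℝ) * (2 * a + 2 * N + 5)) /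
      ((2 * a + N + 3 : ℝ) * (2 * N + 5)) := by
    rw [eq_div_iff (by positivity)]
    push_cast at hU
    rw [show N + 2 + 1 = N + 1 + 2 by omega]
    linear_combination hU
  rw [hU']
  have nH := fun n => (H_pos n).ne'
  have nG := fun n => (G_pos n).ne'
  have nJ := fun n => (J_pos n).ne'
  have ng := fun n => (g_pos n).ne'
  have nF := fun n => (F_pos a n).ne'
  have nU := (rowU_pos a (N + 1)).ne'
  push_cast
  field_simp [nH, nG, nJ, ng, nF, nU]
  ring

lemma H_rel (k : ℕ) : H (k + 2) * H k = (H (k + 1)) ^ 2 * (k + 1) := by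
  rw [H_succ (k + 1), H_succ k, Nat.factorial_succ]
  push_cast; ring

lemma core (a b x n : ℕ) (hb : 1 ≤ b) :
    (fx a b (x + 1) * fn a b (n + 2) * ft a b (x + n + 3) /
        H (2 * a + 2 * b + 1 + (2 * x + n + 4))) *
      (fx a b (x + 1) * fn a b n * ft a b (x + n + 1) /
        H (2 * a + 2 * b + 1 + (2 * x + n + 2))) =
    (fx a b (x + 1) * fn a b (n + 1) * ft a b (x + n + 2) /
        H (2 * a + 2 * b + 1 + (2 * x + n + 3))) ^ 2 +
    (fx a b (x + 2) * fn a b n * ft a b (x + n + 2) /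
        H (2 * a + 2 * b + 1 + (2 * x + n + 4))) *
      (fx a b x * fn a b (n + 2) * ft a b (x + n + 2) /
        H (2 * a + 2 * b + 1 + (2 * x + n + 2))) := by
  have h1 := fx_rel a b x
  have h2 := ft_rel a b (x + n + 1)
  have h3 := fn_rel a b n hb
  have h4 := H_rel (2 * a + 2 * b + 1 + (2 * x + n + 2))
  rw [show x + n + 1 + 2 = x + n + 3 by omega, show x + n + 1 + 1 = x + n + 2 by omega] at h2
  rw [show 2 * a + 2 * b + 1 + (2 * x + n + 2) + 2 = 2 * a + 2 * b + 1 + (2 * x + n + 4) by omega,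
    show 2 * a + 2 * b + 1 + (2 * x + n + 2) + 1 = 2 * a + 2 * b + 1 + (2 * x + n + 3) by omega]
    at h4
  have nH2 := (H_pos (2 * a + 2 * b + 1 + (2 * x + n + 2))).ne'
  have nH3 := (H_pos (2 * a + 2 * b + 1 + (2 * x + n + 3))).ne'
  have nH4 := (H_pos (2 * a + 2 * b + 1 + (2 * x + n + 4))).ne'
  generalize H (2 * a + 2 * b + 1 + (2 * x + n + 2)) = w2 at *
  generalize H (2 * a + 2 * b + 1 + (2 * x + n + 3)) = w3 at *
  generalize H (2 * a + 2 * b + 1 + (2 * x + n + 4)) = w4 at *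
  push_cast at h2 h4
  have e1 : ∀ p q r p' q' r' : ℝ, (p * q * r / w4) * (p' * q' * r' / w2) =
      p * p' * (q * q') * (r * r') / (w4 * w2) := by intros; field_simp
  rw [e1, e1, h1, h2, h4, div_pow, mul_pow, mul_pow, h3]
  have : ((2 : ℝ) * a + 2 * b + 1 + (2 * x + n + 2) + 1) ≠ 0 := by positivity
  field_simp
  ring

end PsiKuo

/-- Kuo condensation recurrence for `ψ`. -/
theorem claim_psi_kuo (x y z a b : ℕ) (hx : 1 ≤ x) (hy : 1 ≤ y) (hz : 1 ≤ z)
    (ha : 1 ≤ a) (hb : 1 ≤ b) :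
    psi x y z a b * psi x (y - 1) (z - 1) a b =
      psi x (y - 1) z a b * psi x y (z - 1) a b +
        psi (x + 1) (y - 1) (z - 1) a b * psi (x - 1) y z a b := by
  obtain ⟨x, rfl⟩ : ∃ k, x = k + 1 := ⟨x - 1, by omega⟩
  obtain ⟨y, rfl⟩ : ∃ k, y = k + 1 := ⟨y - 1, by omega⟩
  obtain ⟨z, rfl⟩ : ∃ k, z = k + 1 := ⟨z - 1, by omega⟩
  simp only [Nat.add_sub_cancel]
  have hc := PsiKuo.core a b x (y + z) hb
  simp only [PsiKuo.psi_eq]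
  rw [show y + 1 + (z + 1) = y + z + 2 by omega, show y + 1 + z = y + z + 1 by omega,
    show y + (z + 1) = y + z + 1 by omega,
    show x + 1 + (y + z + 2) = x + (y + z) + 3 by omega,
    show x + 1 + (y + z + 1) = x + (y + z) + 2 by omega,
    show x + 1 + (y + z) = x + (y + z) + 1 by omega,
    show x + 1 + 1 + (y + z) = x + (y + z) + 2 by omega,
    show x + (y + z + 2) = x + (y + z) + 2 by omega,
    show 2 * (x + 1) + (y + z + 2) = 2 * x + (y + z) + 4 by omega,
    show 2 * (x + 1) + (y + z + 1) = 2 * x + (y + z) + 3 by omega,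
    show 2 * (x + 1) + (y + z) = 2 * x + (y + z) + 2 by omega,
    show 2 * (x + 1 + 1) + (y + z) = 2 * x + (y + z) + 4 by omega,
    show 2 * x + (y + z + 2) = 2 * x + (y + z) + 2 by omega,
    show x + 1 + 1 + y = x + 1 + (y + 1) by omega,
    show x + 1 + 1 + z = x + 1 + (z + 1) by omega,
    show x + (y + 1) = x + 1 + y by omega,
    show x + (z + 1) = x + 1 + z by omega,
    show x + 1 + 1 = x + 2 by omega]
  linear_combination (PsiKuo.K a b ^ 2 * PsiKuo.fy a b y * PsiKuo.fy a b (y + 1) *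
    PsiKuo.fz a b z * PsiKuo.fz a b (z + 1) * PsiKuo.fxy a b (x + 1 + y) *
    PsiKuo.fxy a b (x + 1 + (y + 1)) * PsiKuo.fxz a b (x + 1 + z) *
    PsiKuo.fxz a b (x + 1 + (z + 1))) * hc
end
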